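/- Let R be a commutative Noetherian ring, M a finitely generated R-module of finite dimension d, and P a finite set of maximal ideals of R. Let 𝔐 = ∩_{m ∈ P} m and let T denote the 𝔐-adic completion of R. Let a and b be ideals of R with Supp_R H^d_a(M) = Supp_R H^d_b(M) = P. If Att_T H^d_a(M) = Att_T H^d_b(M) (for the natural T-module structures these Artinian R-modules carry), then H^d_a(M) ≅ H^d_b(M) as R-modules. -/

import Mathlib

/- Common definitions: local cohomology modules, cohomological dimension, module dimension,
secondary representations and attached primes. -/

open CategoryTheory TensorProduct

/-- The `i`-th local cohomology module `H^i_a(M)`, as a type with its `R`-module structure. -/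
noncomputable def TopLC (R : Type) [CommRing R] (a : Ideal R) (i : ℕ)
    (M : Type) [AddCommGroup M] [Module R M] : Type :=
  ((localCohomology a i).obj (ModuleCat.of R M))

noncomputable instance (R : Type) [CommRing R] (a : Ideal R) (i : ℕ)
    (M : Type) [AddCommGroup M] [Module R M] : AddCommGroup (TopLC R a i M) :=
  inferInstanceAs (AddCommGroup ((localCohomology a i).obj (ModuleCat.of R M)))

noncomputable instance (R : Type) [CommRing R] (a : Ideal R) (i : ℕ)
    (M : Type) [AddCommGroup M] [Module R M] : Module R (TopLC R a i M) :=
  inferInstanceAs (Module R ((localCohomology a i).obj (ModuleCat.of R M)))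

/-- The cohomological dimension `cd_R(a, M) = sup { i | H^i_a(M) ≠ 0 }`,
with value `⊥` if all local cohomology modules vanish. -/
noncomputable def cohDim (R : Type) [CommRing R] (a : Ideal R)
    (M : Type) [AddCommGroup M] [Module R M] : WithBot ℕ∞ :=
  sSup {n : WithBot ℕ∞ | ∃ i : ℕ, n = (i : ℕ) ∧ Nontrivial (TopLC R a i M)}

/-- The (Krull) dimension of a module, i.e. the Krull dimension of its support. -/
noncomputable def moduleDim (R : Type) [CommRing R]
    (M : Type) [AddCommGroup M] [Module R M] : WithBot ℕ∞ :=
  Order.krullDim (Module.support R M)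

/-- `Assh_R M`: the associated primes `p` of `M` with `dim R/p = dim M`. -/
noncomputable def Assh (R : Type) [CommRing R]
    (M : Type) [AddCommGroup M] [Module R M] : Set (Ideal R) :=
  { p | p ∈ associatedPrimes R M ∧ ringKrullDim (R ⧸ p) = moduleDim R M }

/-- A submodule `S` is secondary if `S ≠ 0` and every `r : R` acts on `S` either
surjectively or nilpotently. -/
def IsSecondarySub (R : Type) [CommRing R] {M : Type} [AddCommGroup M] [Module R M]
    (S : Submodule R M) : Prop :=
  S ≠ ⊥ ∧ ∀ r : R, (∀ m ∈ S, ∃ s ∈ S, r • s = m) ∨ (∃ n : ℕ, ∀ m ∈ S, r ^ n • m = 0)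

/-- A module is representable if it is the (finite) sum of secondary submodules. -/
def IsRepresentable (R : Type) [CommRing R] (M : Type) [AddCommGroup M] [Module R M] : Prop :=
  ∃ (n : ℕ) (S : Fin n → Submodule R M), (∀ i, IsSecondarySub R (S i)) ∧ (⨆ i, S i) = ⊤

/-- A minimal secondary representation: secondary submodules summing to the whole module,
with pairwise distinct attached primes, none contained in the sum of the others. -/
def IsMinimalRep (R : Type) [CommRing R] {M : Type} [AddCommGroup M] [Module R M]
    {n : ℕ} (S : Fin n → Submodule R M) : Prop :=
  (∀ i, IsSecondarySub R (S i)) ∧ (⨆ i, S i) = ⊤ ∧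
    (Function.Injective fun i => (S i).annihilator.radical) ∧
    ∀ j, ¬ (S j ≤ ⨆ i ∈ ({j}ᶜ : Set (Fin n)), S i)

/-- The attached primes of a module: the radicals of the annihilators of the terms of a
minimal secondary representation. -/
def AttachedPrimes (R : Type) [CommRing R] (M : Type) [AddCommGroup M] [Module R M] :
    Set (Ideal R) :=
  { p | ∃ (n : ℕ) (S : Fin n → Submodule R M), IsMinimalRep R S ∧
      ∃ i, p = (S i).annihilator.radical }

/-- `stab b N = ⟨b⟩N = ⋂ₙ bⁿN`. -/
def stab {R M : Type} [CommRing R] [AddCommGroup M] [Module R M]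
    (b : Ideal R) (N : Submodule R M) : Submodule R M :=
  ⨅ n : ℕ, b ^ n • N

section DerivedSequence

open Limits

universe v u v' u'

variable {C : Type u} [Category.{v} C] [Abelian C]
  {D : Type u'} [Category.{v'} D] [Abelian D]
  {F₁ F₂ F₃ : C ⥤ D} [F₁.Additive] [F₂.Additive] [F₃.Additive]

/-- A short complex of additive functors, applied to a chain complex. -/
noncomputable def functorShortComplex (α : F₁ ⟶ F₂) (β : F₂ ⟶ F₃) (w : α ≫ β = 0)
    (K : ChainComplex C ℕ) : ShortComplex (ChainComplex D ℕ) :=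
  ShortComplex.mk ((NatTrans.mapHomologicalComplex α _).app K)
    ((NatTrans.mapHomologicalComplex β _).app K) (by
      ext n
      exact NatTrans.congr_app w (K.X n))

/-- Functoriality of `functorShortComplex` in the complex. -/
noncomputable def functorShortComplexMap (α : F₁ ⟶ F₂) (β : F₂ ⟶ F₃) (w : α ≫ β = 0)
    {K L : ChainComplex C ℕ} (φ : K ⟶ L) :
    functorShortComplex α β w K ⟶ functorShortComplex α β w L where
  τ₁ := (F₁.mapHomologicalComplex _).map φ
  τ₂ := (F₂.mapHomologicalComplex _).map φ
  τ₃ := (F₃.mapHomologicalComplex _).map φ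
  comm₁₂ := (NatTrans.mapHomologicalComplex α _).naturality φ
  comm₂₃ := (NatTrans.mapHomologicalComplex β _).naturality φ

lemma functorShortComplex_shortExact (α : F₁ ⟶ F₂) (β : F₂ ⟶ F₃) (w : α ≫ β = 0)
    (h : ∀ Q : C, Projective Q →
      (ShortComplex.mk (α.app Q) (β.app Q) (NatTrans.congr_app w Q)).ShortExact)
    {X : C} (P : ProjectiveResolution X) :
    (functorShortComplex α β w P.complex).ShortExact :=
  HomologicalComplex.shortExact_of_degreewise_shortExact _ fun n => h _ (P.projective n)

theorem exists_leftDerived_delta [EnoughProjectives C] (α : F₁ ⟶ F₂) (β : F₂ ⟶ F₃) (w : α ≫ β = 0)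
    (h : ∀ Q : C, Projective Q →
      (ShortComplex.mk (α.app Q) (β.app Q) (NatTrans.congr_app w Q)).ShortExact) (i : ℕ) :
    ∃ δ : F₃.leftDerived (i + 1) ⟶ F₁.leftDerived i, ∀ X : C,
      (∃ w₁, (ShortComplex.mk ((NatTrans.leftDerived α i).app X)
        ((NatTrans.leftDerived β i).app X) w₁).Exact) ∧
      (∃ w₂, (ShortComplex.mk ((NatTrans.leftDerived β (i + 1)).app X) (δ.app X) w₂).Exact) ∧
      (∃ w₃, (ShortComplex.mk (δ.app X) ((NatTrans.leftDerived α i).app X) w₃).Exact) := by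
  have hS : ∀ X : C, (functorShortComplex α β w (projectiveResolution X).complex).ShortExact :=
    fun X => functorShortComplex_shortExact α β w h _
  have hij : (ComplexShape.down ℕ).Rel (i + 1) i := by simp
  refine ⟨{ app := fun X => ((projectiveResolution X).isoLeftDerivedObj F₃ (i + 1)).hom ≫
              (hS X).δ (i + 1) i hij ≫ ((projectiveResolution X).isoLeftDerivedObj F₁ i).inv
            naturality := ?_ }, fun X => ?_⟩
  · intro X Y f
    let φ := ProjectiveResolution.lift f (projectiveResolution X) (projectiveResolution Y)
    have hφ := ProjectiveResolution.lift_commutes_zero f (projectiveResolution X)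
      (projectiveResolution Y)
    have e₃ := ProjectiveResolution.isoLeftDerivedObj_hom_naturality f (projectiveResolution X)
      (projectiveResolution Y) φ hφ F₃ (i + 1)
    have e₁ := ProjectiveResolution.isoLeftDerivedObj_inv_naturality f (projectiveResolution X)
      (projectiveResolution Y) φ hφ F₁ i
    have e := HomologicalComplex.HomologySequence.δ_naturality
      (functorShortComplexMap α β w φ) (hS X) (hS Y) (i + 1) i hij
    have glue : ∀ {A A' B B' E E' G G' : D} (u : A ⟶ A') (p : A ⟶ B) (p' : A' ⟶ B')
        (m : B ⟶ B') (δ : B ⟶ E) (δ' : B' ⟶ E') (m' : E ⟶ E') (q : E ⟶ G) (q' : E' ⟶ G')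
        (v : G ⟶ G'), u ≫ p' = p ≫ m → δ ≫ m' = m ≫ δ' → q ≫ v = m' ≫ q' →
        u ≫ p' ≫ δ' ≫ q' = (p ≫ δ ≫ q) ≫ v := by
      intro _ _ _ _ _ _ _ _ u p p' m δ δ' m' q q' v h₁ h₂ h₃
      rw [reassoc_of% h₁, Category.assoc, Category.assoc, h₃, reassoc_of% h₂]
    exact glue _ _ _ _ _ _ _ _ _ _ e₃ e e₁
  · let P := projectiveResolution X
    have key : ∀ {A₁ A₂ A₃ B₁ B₂ B₃ : D} (e₁ : A₁ ≅ B₁) (e₂ : A₂ ≅ B₂) (e₃ : A₃ ≅ B₃)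
        (f : A₁ ⟶ A₂) (g : A₂ ⟶ A₃) (f' : B₁ ⟶ B₂) (g' : B₂ ⟶ B₃) (w' : f' ≫ g' = 0),
        f = e₁.hom ≫ f' ≫ e₂.inv → g = e₂.hom ≫ g' ≫ e₃.inv →
        (ShortComplex.mk f' g' w').Exact → ∃ w, (ShortComplex.mk f g w).Exact := by
      intro A₁ A₂ A₃ B₁ B₂ B₃ e₁ e₂ e₃ f g f' g' w' hf hg hex
      refine ⟨by simp [hf, hg, reassoc_of% w'], ?_⟩
      refine ShortComplex.exact_of_iso (ShortComplex.isoMk e₁.symm e₂.symm e₃.symm ?_ ?_) hex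
      · simp [hf]
      · simp [hg]
    refine ⟨?_, ?_, ?_⟩
    · exact key _ _ _ _ _ _ _ _ (P.leftDerived_app_eq α i) (P.leftDerived_app_eq β i)
        ((hS X).homology_exact₂ i)
    · exact key _ _ _ _ _ _ _ _ (P.leftDerived_app_eq β (i + 1)) rfl
        ((hS X).homology_exact₃ (i + 1) i hij)
    · exact key _ _ _ _ _ _ _ _ rfl (P.leftDerived_app_eq α i)
        ((hS X).homology_exact₁ (i + 1) i hij)

end DerivedSequence

section HomFunctor

open Opposite Limits

variable {R : Type} [CommRing R]

/-- The contravariant functor `Hom(-, M)`, with values in the opposite category. -/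
noncomputable abbrev homFunctor (M : ModuleCat.{0} R) :
    ModuleCat.{0} R ⥤ (ModuleCat.{0} R)ᵒᵖ :=
  ((linearYoneda R (ModuleCat.{0} R)).obj M).rightOp

/-- Functoriality of `homFunctor`. -/
noncomputable abbrev homFunctorMap {M N : ModuleCat.{0} R} (f : M ⟶ N) :
    homFunctor N ⟶ homFunctor M :=
  NatTrans.rightOp ((linearYoneda R (ModuleCat.{0} R)).map f)

instance (M : ModuleCat.{0} R) :
    PreservesFiniteLimits ((linearYoneda R (ModuleCat.{0} R)).obj M) := by
  refine ⟨fun J _ _ => ?_⟩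
  have : PreservesLimitsOfShape J
      ((linearYoneda R (ModuleCat.{0} R)).obj M ⋙ forget (ModuleCat.{0} R)) :=
    inferInstanceAs (PreservesLimitsOfShape J (yoneda.obj M))
  exact preservesLimitsOfShape_of_reflects_of_preserves _ (forget (ModuleCat.{0} R))

instance (M : ModuleCat.{0} R) : PreservesFiniteColimits (homFunctor M) :=
  preservesFiniteColimits_rightOp _

end HomFunctor

section NatTransLeftDerived

open Limits

universe v u v' u'

variable {C : Type u} [Category.{v} C] [Abelian C] [EnoughProjectives C]
  {D : Type u'} [Category.{v'} D] [Abelian D]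
  {F G : C ⥤ D} [F.Additive] [G.Additive]

lemma leftDerived_fromLeftDerivedZero (α : F ⟶ G) (X : C) :
    (NatTrans.leftDerived α 0).app X ≫ G.fromLeftDerivedZero.app X =
      F.fromLeftDerivedZero.app X ≫ α.app X := by
  let P := projectiveResolution X
  have h : HomologicalComplex.opcyclesMap ((NatTrans.mapHomologicalComplex α _).app P.complex) 0 ≫
      P.fromLeftDerivedZero' G = P.fromLeftDerivedZero' F ≫ α.app X := by
    rw [← cancel_epi (HomologicalComplex.pOpcycles _ _), HomologicalComplex.p_opcyclesMap_assoc,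
      P.pOpcycles_comp_fromLeftDerivedZero', P.pOpcycles_comp_fromLeftDerivedZero'_assoc]
    exact (α.naturality _).symm
  have glue : ∀ {A B A' B' E E' G G' : D} (p : A ⟶ B) (m : B ⟶ B') (e : A' ≅ B') (ι : B ⟶ E)
      (ι' : B' ⟶ E') (o : E ⟶ E') (g : E ⟶ G) (g' : E' ⟶ G') (a : G ⟶ G'), m ≫ ι' = ι ≫ o →
      o ≫ g' = g ≫ a → (p ≫ m ≫ e.inv) ≫ e.hom ≫ ι' ≫ g' = (p ≫ ι ≫ g) ≫ a := by
    intro _ _ _ _ _ _ _ _ p m e ι ι' o g g' a h₁ h₂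
    simp only [Category.assoc, Iso.inv_hom_id_assoc, reassoc_of% h₁, h₂]
  rw [P.leftDerived_app_eq α 0, P.fromLeftDerivedZero_eq, P.fromLeftDerivedZero_eq]
  exact glue _ _ _ _ _ _ _ _ _ (HomologicalComplex.homologyι_naturality _ _) h

lemma leftDerived_add (α β γ : F ⟶ G) (h : ∀ X, γ.app X = α.app X + β.app X) (i : ℕ) (X : C) :
    (NatTrans.leftDerived γ i).app X =
      (NatTrans.leftDerived α i).app X + (NatTrans.leftDerived β i).app X := by
  let P := projectiveResolution X
  have : (NatTrans.mapHomologicalComplex γ (ComplexShape.down ℕ)).app P.complex =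
      (NatTrans.mapHomologicalComplex α _).app P.complex +
        (NatTrans.mapHomologicalComplex β _).app P.complex := by
    ext n
    exact h _
  rw [P.leftDerived_app_eq α, P.leftDerived_app_eq β, P.leftDerived_app_eq γ, this,
    Functor.map_add]
  have glue : ∀ {A B B' E : D} (p : A ⟶ B) (m m' : B ⟶ B') (q : B' ⟶ E),
      p ≫ (m + m') ≫ q = p ≫ m ≫ q + p ≫ m' ≫ q := by simp
  exact glue _ _ _ _

lemma leftDerived_center (θ : 𝟭 D ⟶ 𝟭 D) (α : F ⟶ F) (h : ∀ X, α.app X = θ.app (F.obj X))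
    (i : ℕ) (X : C) :
    (NatTrans.leftDerived α i).app X = θ.app ((F.leftDerived i).obj X) := by
  let P := projectiveResolution X
  let K := (F.mapHomologicalComplex (ComplexShape.down ℕ)).obj P.complex
  have key : HomologicalComplex.homologyMap
      ((NatTrans.mapHomologicalComplex α (ComplexShape.down ℕ)).app P.complex) i =
      θ.app (K.homology i) := by
    rw [← cancel_epi (K.homologyπ i)]
    have h₁ : HomologicalComplex.cyclesMap
      ((NatTrans.mapHomologicalComplex α (ComplexShape.down ℕ)).app P.complex) i =
      θ.app (K.cycles i) := by
      rw [← cancel_mono (K.iCycles i)]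
      refine (HomologicalComplex.cyclesMap_i _ _).trans ?_
      refine Eq.trans ?_ (θ.naturality (K.iCycles i))
      exact congrArg (K.iCycles i ≫ ·) (h _)
    refine (HomologicalComplex.homologyπ_naturality _ _).trans ?_
    rw [h₁]
    exact (θ.naturality (K.homologyπ i)).symm
  rw [P.leftDerived_app_eq α]
  have e := θ.naturality (P.isoLeftDerivedObj F i).inv
  refine (congrArg (fun t => (P.isoLeftDerivedObj F i).hom ≫ t ≫
    (P.isoLeftDerivedObj F i).inv) key).trans ?_
  refine (congrArg (fun t => (P.isoLeftDerivedObj F i).hom ≫ t) e.symm).trans ?_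
  exact Iso.hom_inv_id_assoc _ _

end NatTransLeftDerived

section ExtSequence

open Opposite Limits

variable {R : Type} [CommRing R]

/-- The module `Ext^i(X, M)`, computed from a projective resolution of `X`. -/
noncomputable abbrev extObj (i : ℕ) (X M : ModuleCat.{0} R) : ModuleCat.{0} R :=
  ((Ext R (ModuleCat.{0} R) i).obj (op X)).obj M

/-- Functoriality of `extObj` in the second variable. -/
noncomputable abbrev extMap (i : ℕ) (X : ModuleCat.{0} R) {M N : ModuleCat.{0} R} (f : M ⟶ N) :
    extObj i X M ⟶ extObj i X N :=
  ((Ext R (ModuleCat.{0} R) i).obj (op X)).map f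

/-- Functoriality of `extObj` in the first variable. -/
noncomputable abbrev extPre (i : ℕ) {X Y : ModuleCat.{0} R} (g : X ⟶ Y) (M : ModuleCat.{0} R) :
    extObj i Y M ⟶ extObj i X M :=
  ((Ext R (ModuleCat.{0} R) i).map g.op).app M

theorem exists_ext_delta {S : ShortComplex (ModuleCat.{0} R)} (hS : S.ShortExact) (i : ℕ) :
    ∃ δ : ∀ X : ModuleCat.{0} R, extObj i X S.X₃ ⟶ extObj (i + 1) X S.X₁,
      (∀ {X Y : ModuleCat.{0} R} (g : X ⟶ Y), extPre i g S.X₃ ≫ δ X = δ Y ≫ extPre (i + 1) g S.X₁) ∧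
      ∀ X : ModuleCat.{0} R,
        Function.Exact (extMap i X S.f).hom (extMap i X S.g).hom ∧
        Function.Exact (extMap i X S.g).hom (δ X).hom ∧
        Function.Exact (δ X).hom (extMap (i + 1) X S.f).hom := by
  have w : homFunctorMap S.g ≫ homFunctorMap S.f = 0 := by
    ext X
    apply Quiver.Hom.unop_inj
    ext (h : unop (op X) ⟶ S.X₁)
    change h ≫ S.f ≫ S.g = 0
    simp
  have hex : ∀ Q : ModuleCat.{0} R, Projective Q →
      (ShortComplex.mk ((homFunctorMap S.g).app Q) ((homFunctorMap S.f).app Q)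
        (NatTrans.congr_app w Q)).ShortExact := by
    intro Q hQ
    let S' : ShortComplex (ModuleCat.{0} R) :=
      ShortComplex.mk (((linearYoneda R (ModuleCat.{0} R)).map S.f).app (op Q))
        (((linearYoneda R (ModuleCat.{0} R)).map S.g).app (op Q)) (by
          ext (h : Q ⟶ S.X₁)
          change (h ≫ S.f) ≫ S.g = 0
          simp)
    have := hS.mono_f
    have := hS.epi_g
    have hS' : S'.ShortExact := by
      refine ShortComplex.ShortExact.mk' ?_ ?_ ?_
      · rw [ShortComplex.moduleCat_exact_iff]
        intro (x : Q ⟶ S.X₂) (hx : x ≫ S.g = 0)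
        exact ⟨hS.exact.lift x hx, hS.exact.lift_f x hx⟩
      · rw [ModuleCat.mono_iff_injective]
        intro (x : Q ⟶ S.X₁) (y : Q ⟶ S.X₁) (h : x ≫ S.f = y ≫ S.f)
        exact (cancel_mono S.f).1 h
      · rw [ModuleCat.epi_iff_surjective]
        intro (x : Q ⟶ S.X₃)
        exact ⟨Projective.factorThru x S.g, Projective.factorThru_comp x S.g⟩
    exact hS'.op
  obtain ⟨δ, hδ⟩ := exists_leftDerived_delta (homFunctorMap S.g) (homFunctorMap S.f) w hex i
  refine ⟨fun X => (δ.app X).unop, fun g => ?_, fun X => ?_⟩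
  · exact congrArg Quiver.Hom.unop (δ.naturality g).symm
  · obtain ⟨⟨w₁, h₁⟩, -, -⟩ := hδ X
    obtain ⟨-, ⟨w₂, h₂⟩, ⟨w₃, h₃⟩⟩ := hδ X
    exact ⟨(ShortComplex.ShortExact.moduleCat_exact_iff_function_exact _).1 h₁.unop,
      (ShortComplex.ShortExact.moduleCat_exact_iff_function_exact _).1 h₃.unop,
      (ShortComplex.ShortExact.moduleCat_exact_iff_function_exact _).1 h₂.unop⟩

lemma isZero_extObj_of_injective (i : ℕ) (X I : ModuleCat.{0} R) [Injective I] :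
    IsZero (extObj (i + 1) X I) := by
  let P := projectiveResolution X
  refine IsZero.unop (X := ((homFunctor I).leftDerived (i + 1)).obj X) ?_
  refine IsZero.of_iso ?_ (P.isoLeftDerivedObj (homFunctor I) (i + 1))
  rw [HomologicalComplex.homologyFunctor_obj]
  rw [← HomologicalComplex.exactAt_iff_isZero_homology,
    HomologicalComplex.exactAt_iff' _ (i + 2) (i + 1) i (by simp) (by simp)]
  have hP := P.exact_succ i
  rw [← ShortComplex.exact_unop_iff, ShortComplex.moduleCat_exact_iff]
  intro (x : P.complex.X (i + 1) ⟶ I) (hx : P.complex.d (i + 2) (i + 1) ≫ x = 0)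
  exact ⟨hP.descToInjective x hx, hP.comp_descToInjective x hx⟩

lemma extMap_smul_id (i : ℕ) (X M : ModuleCat.{0} R) (r : R) (x : extObj i X M) :
    (extMap i X (ModuleCat.ofHom (r • LinearMap.id : M →ₗ[R] M))).hom x = r • x := by
  let θ : 𝟭 (ModuleCat.{0} R)ᵒᵖ ⟶ 𝟭 (ModuleCat.{0} R)ᵒᵖ :=
    { app := fun Y => (ModuleCat.ofHom (r • LinearMap.id : Y.unop →ₗ[R] Y.unop)).op
      naturality := fun Y Z f => by
        apply Quiver.Hom.unop_inj
        ext y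
        simp }
  have := leftDerived_center (F := homFunctor M) θ
    (homFunctorMap (ModuleCat.ofHom (r • LinearMap.id : M →ₗ[R] M))) (fun Y => rfl) i X
  exact congrArg (fun t => t.unop.hom x) this

lemma extMap_add (i : ℕ) (X : ModuleCat.{0} R) {M N : ModuleCat.{0} R} (f g : M ⟶ N) :
    extMap i X (f + g) = extMap i X f + extMap i X g := by
  have := leftDerived_add (homFunctorMap f) (homFunctorMap g) (homFunctorMap (f + g))
    (fun Y => by
      apply Quiver.Hom.unop_inj
      ext (h : Y ⟶ M)
      exact Preadditive.comp_add _ _ _ h f g) i X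
  exact congrArg Quiver.Hom.unop this

/-- The isomorphism `Hom(X, M) ≅ Ext^0(X, M)`. -/
noncomputable def homToExt (X M : ModuleCat.{0} R) :
    ((linearYoneda R (ModuleCat.{0} R)).obj M).obj (op X) ⟶ extObj 0 X M :=
  ((homFunctor M).fromLeftDerivedZero.app X).unop

instance (X M : ModuleCat.{0} R) : IsIso (homToExt X M) := by
  have : IsIso ((homFunctor M).fromLeftDerivedZero.app X) :=
    inferInstanceAs (IsIso ((homFunctor M).leftDerivedZeroIsoSelf.app X).hom)
  exact isIso_unop _

lemma homToExt_pre {X Y : ModuleCat.{0} R} (g : X ⟶ Y) (M : ModuleCat.{0} R) (h : Y ⟶ M) :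
    (extPre 0 g M).hom ((homToExt Y M).hom h) = (homToExt X M).hom (g ≫ h) := by
  have := congrArg Quiver.Hom.unop ((homFunctor M).fromLeftDerivedZero.naturality g)
  exact congrArg (fun t => t.hom h) this

lemma homToExt_map (X : ModuleCat.{0} R) {M N : ModuleCat.{0} R} (f : M ⟶ N) (h : X ⟶ M) :
    (extMap 0 X f).hom ((homToExt X M).hom h) = (homToExt X N).hom (h ≫ f) := by
  have := congrArg Quiver.Hom.unop (leftDerived_fromLeftDerivedZero (homFunctorMap f) X)
  exact congrArg (fun t => t.hom h) this

end ExtSequence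

namespace TopLC

open Opposite Limits

section Colimit

variable {R : Type} [CommRing R] (a : Ideal R) (i : ℕ)

/-- The inverse system `R ⧸ a ^ n`. -/
noncomputable abbrev quotSystem : ℕᵒᵖ ⥤ ModuleCat.{0} R :=
  localCohomology.ringModIdeals (localCohomology.idealPowersDiagram a)

/-- The direct system of the functors `Ext^i(R ⧸ a ^ n, -)`. -/
noncomputable abbrev extSystem : (ℕᵒᵖ)ᵒᵖ ⥤ ModuleCat.{0} R ⥤ ModuleCat.{0} R :=
  localCohomology.diagram (localCohomology.idealPowersDiagram a) i

/-- The colimit cocone presenting `H^i_a(M)`. -/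
noncomputable def cocone (M : ModuleCat.{0} R) :
    Cocone (extSystem a i ⋙ (evaluation _ _).obj M) :=
  ((evaluation _ _).obj M).mapCocone (colimit.cocone (extSystem a i))

/-- `cocone` is a colimit cocone. -/
noncomputable def isColimitCocone (M : ModuleCat.{0} R) : IsColimit (cocone a i M) :=
  isColimitOfPreserves ((evaluation _ _).obj M) (colimit.isColimit (extSystem a i))

/-- The canonical map `Ext^i(R ⧸ a ^ n, M) → H^i_a(M)`. -/
noncomputable def ι (n : ℕᵒᵖ) (M : ModuleCat.{0} R) :
    extObj i ((quotSystem a).obj n) M ⟶ (localCohomology a i).obj M :=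
  (cocone a i M).ι.app (op n)

lemma ι_naturality (n : ℕᵒᵖ) {M N : ModuleCat.{0} R} (f : M ⟶ N) :
    extMap i _ f ≫ ι a i n N = ι a i n M ≫ (localCohomology a i).map f :=
  ((colimit.ι (extSystem a i) (op n)).naturality f)

lemma ι_pre {m n : ℕᵒᵖ} (g : m ⟶ n) (M : ModuleCat.{0} R) :
    extPre i ((quotSystem a).map g) M ≫ ι a i m M = ι a i n M :=
  (cocone a i M).w g.op

lemma exists_rep (M : ModuleCat.{0} R) (x : (localCohomology a i).obj M) :
    ∃ n y, (ι a i n M).hom y = x := by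
  obtain ⟨j, y, hy⟩ := Concrete.isColimit_exists_rep _ (isColimitCocone a i M) x
  exact ⟨j.unop, y, hy⟩

lemma exists_of_ι_eq_zero {M : ModuleCat.{0} R} {n : ℕᵒᵖ}
    (y : extObj i ((quotSystem a).obj n) M) (hy : (ι a i n M).hom y = 0) :
    ∃ (m : ℕᵒᵖ) (g : m ⟶ n), (extPre i ((quotSystem a).map g) M).hom y = 0 := by
  obtain ⟨j, f, g, h⟩ := Concrete.isColimit_exists_of_rep_eq _ (isColimitCocone a i M)
    (i := op n) (j := op n) y 0 (by
      refine Eq.trans hy ?_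
      exact (map_zero (ι a i n M).hom).symm)
  refine ⟨j.unop, f.unop, ?_⟩
  refine Eq.trans h ?_
  exact map_zero (((extSystem a i ⋙ (evaluation _ _).obj M).map g).hom)

lemma exists_desc (M N : ModuleCat.{0} R)
    (φ : ∀ n, extObj i ((quotSystem a).obj n) M ⟶ N)
    (hφ : ∀ {m n : ℕᵒᵖ} (g : m ⟶ n), extPre i ((quotSystem a).map g) M ≫ φ m = φ n) :
    ∃ ψ : (localCohomology a i).obj M ⟶ N, ∀ n, ι a i n M ≫ ψ = φ n :=
  ⟨(isColimitCocone a i M).desc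
    { pt := N
      ι := { app := fun j => φ j.unop
             naturality := fun _ _ f => (hφ f.unop).trans (Category.comp_id _).symm } },
    fun n => (isColimitCocone a i M).fac _ (op n)⟩

theorem exists_delta_of_shortExact {S : ShortComplex (ModuleCat.{0} R)} (hS : S.ShortExact) :
    ∃ δ : (localCohomology a i).obj S.X₃ ⟶ (localCohomology a (i + 1)).obj S.X₁,
      Function.Exact ((localCohomology a i).map S.f).hom ((localCohomology a i).map S.g).hom ∧
      Function.Exact ((localCohomology a i).map S.g).hom δ.hom ∧
      Function.Exact δ.hom ((localCohomology a (i + 1)).map S.f).hom := by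
  obtain ⟨δ, hδ, hex⟩ := exists_ext_delta hS i
  obtain ⟨Δ, hΔ⟩ := exists_desc a i S.X₃ ((localCohomology a (i + 1)).obj S.X₁)
    (fun n => δ _ ≫ ι a (i + 1) n S.X₁) (fun {m n} g => by
      rw [← ι_pre a (i + 1) g, ← Category.assoc, hδ, Category.assoc])
  have main : ∀ {k l p : ℕ} {A B C : ModuleCat.{0} R}
      (u : ∀ n, extObj k ((quotSystem a).obj n) A ⟶ extObj l ((quotSystem a).obj n) B)
      (v : ∀ n, extObj l ((quotSystem a).obj n) B ⟶ extObj p ((quotSystem a).obj n) C)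
      (U : (localCohomology a k).obj A ⟶ (localCohomology a l).obj B)
      (V : (localCohomology a l).obj B ⟶ (localCohomology a p).obj C)
      (_ : ∀ n, ι a k n A ≫ U = u n ≫ ι a l n B)
      (_ : ∀ n, ι a l n B ≫ V = v n ≫ ι a p n C)
      (_ : ∀ {m n : ℕᵒᵖ} (g : m ⟶ n), extPre l ((quotSystem a).map g) B ≫ v m =
        v n ≫ extPre p ((quotSystem a).map g) C)
      (_ : ∀ n, Function.Exact (u n).hom (v n).hom),
      Function.Exact U.hom V.hom := by
    intro k l p A B C u v U V hU hV hv huv x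
    constructor
    · intro hx
      obtain ⟨n, y, rfl⟩ := exists_rep a l B x
      have h₁ : (ι a p n C).hom ((v n).hom y) = 0 :=
        (congrArg (fun t => t.hom y) (hV n)).symm.trans hx
      obtain ⟨m, g, h₂⟩ := exists_of_ι_eq_zero a p _ h₁
      have h₃ : (v m).hom ((extPre l ((quotSystem a).map g) B).hom y) = 0 :=
        (congrArg (fun t => t.hom y) (hv g)).trans h₂
      obtain ⟨z, hz⟩ := (huv m _).1 h₃
      refine ⟨(ι a k m A).hom z, ?_⟩
      refine (congrArg (fun t => t.hom z) (hU m)).trans ?_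
      refine (congrArg (ι a l m B).hom hz).trans ?_
      exact congrArg (fun t => t.hom y) (ι_pre a l g B)
    · rintro ⟨w, rfl⟩
      obtain ⟨n, z, rfl⟩ := exists_rep a k A w
      have h₁ : U.hom ((ι a k n A).hom z) = (ι a l n B).hom ((u n).hom z) :=
        congrArg (fun t => t.hom z) (hU n)
      have h₂ : V.hom ((ι a l n B).hom ((u n).hom z)) = (ι a p n C).hom ((v n).hom ((u n).hom z)) :=
        congrArg (fun t => t.hom ((u n).hom z)) (hV n)
      rw [h₁, h₂, (huv n).apply_apply_eq_zero, map_zero]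
  refine ⟨Δ, ?_, ?_, ?_⟩
  · exact main (fun n => extMap i _ S.f) (fun n => extMap i _ S.g) _ _
      (fun n => (ι_naturality a i n S.f).symm) (fun n => (ι_naturality a i n S.g).symm)
      (fun g => ((Ext R (ModuleCat.{0} R) i).map ((quotSystem a).map g).op).naturality S.g |>.symm)
      (fun n => (hex _).1)
  · exact main (fun n => extMap i _ S.g) (fun n => δ _) _ _
      (fun n => (ι_naturality a i n S.g).symm) hΔ (fun g => hδ _)
      (fun n => (hex _).2.1)
  · exact main (fun n => δ _) (fun n => extMap (i + 1) _ S.f) _ _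
      hΔ (fun n => (ι_naturality a (i + 1) n S.f).symm)
      (fun g =>
        ((Ext R (ModuleCat.{0} R) (i + 1)).map ((quotSystem a).map g).op).naturality S.f |>.symm)
      (fun n => (hex _).2.2)

end Colimit

end TopLC

namespace TopLC

open Opposite Limits

variable {R : Type} [CommRing R] (a : Ideal R) (i : ℕ)
  {M N L : Type} [AddCommGroup M] [Module R M] [AddCommGroup N] [Module R N]
  [AddCommGroup L] [Module R L]

/-- Functoriality of local cohomology. -/
noncomputable def map (f : M →ₗ[R] N) : TopLC R a i M →ₗ[R] TopLC R a i N :=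
  ((localCohomology a i).map (ModuleCat.ofHom f)).hom

lemma map_id : map a i (LinearMap.id : M →ₗ[R] M) = LinearMap.id :=
  congrArg ModuleCat.Hom.hom ((localCohomology a i).map_id (ModuleCat.of R M))

lemma map_comp (g : N →ₗ[R] L) (f : M →ₗ[R] N) :
    map a i (g ∘ₗ f) = map a i g ∘ₗ map a i f :=
  congrArg ModuleCat.Hom.hom
    ((localCohomology a i).map_comp (ModuleCat.ofHom f) (ModuleCat.ofHom g))

lemma map_map (g : N →ₗ[R] L) (f : M →ₗ[R] N) (x : TopLC R a i M) :
    map a i g (map a i f x) = map a i (g ∘ₗ f) x := by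
  rw [map_comp]; rfl

lemma map_ι (n : ℕᵒᵖ) (f : M →ₗ[R] N) (y : extObj i ((quotSystem a).obj n) (ModuleCat.of R M)) :
    map a i f ((ι a i n (ModuleCat.of R M)).hom y) =
      (ι a i n (ModuleCat.of R N)).hom ((extMap i _ (ModuleCat.ofHom f)).hom y) :=
  (congrArg (fun t => t.hom y) (ι_naturality a i n (ModuleCat.ofHom f))).symm

protected lemma map_add (f g : M →ₗ[R] N) : map a i (f + g) = map a i f + map a i g := by
  ext x
  obtain ⟨n, y, rfl⟩ := exists_rep a i (ModuleCat.of R M) x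
  refine (map_ι a i n (f + g) y).trans (Eq.trans ?_
    (congrArg₂ (· + ·) (map_ι a i n f y).symm (map_ι a i n g y).symm))
  refine Eq.trans ?_ (_root_.map_add (ι a i n (ModuleCat.of R N)).hom _ _)
  exact congrArg _ (congrArg (fun t => t.hom y)
    (extMap_add i _ (ModuleCat.ofHom f) (ModuleCat.ofHom g)))

lemma map_smul_id (r : R) (x : TopLC R a i M) :
    map a i (r • (LinearMap.id : M →ₗ[R] M)) x = r • x := by
  obtain ⟨n, y, rfl⟩ := exists_rep a i (ModuleCat.of R M) x
  rw [map_ι]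
  refine Eq.trans ?_ (_root_.map_smul (ι a i n (ModuleCat.of R M)).hom r y)
  exact congrArg _ (extMap_smul_id i _ (ModuleCat.of R M) r y)

protected lemma map_smul (r : R) (f : M →ₗ[R] N) : map a i (r • f) = r • map a i f := by
  ext x
  rw [show r • f = (r • LinearMap.id) ∘ₗ f from rfl, ← map_map, map_smul_id]
  rfl

/-- Local cohomology as a linear map on homomorphisms. -/
noncomputable def mapₗ : (M →ₗ[R] N) →ₗ[R] (TopLC R a i M →ₗ[R] TopLC R a i N) where
  toFun := map a i
  map_add' := TopLC.map_add a i
  map_smul' := TopLC.map_smul a i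

protected lemma map_zero : map a i (0 : M →ₗ[R] N) = 0 :=
  _root_.map_zero (mapₗ a i)

protected lemma map_sum {κ : Type*} (s : Finset κ) (f : κ → M →ₗ[R] N) :
    map a i (∑ k ∈ s, f k) = ∑ k ∈ s, map a i (f k) :=
  _root_.map_sum (mapₗ a i) f s

theorem exists_delta (f : M →ₗ[R] N) (g : N →ₗ[R] L) (hf : Function.Injective f)
    (hg : Function.Surjective g) (hfg : Function.Exact f g) :
    ∃ δ : TopLC R a i L →ₗ[R] TopLC R a (i + 1) M,
      Function.Exact (map a i f) (map a i g) ∧ Function.Exact (map a i g) δ ∧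
      Function.Exact δ (map a (i + 1) f) := by
  let S : ShortComplex (ModuleCat.{0} R) :=
    ShortComplex.mk (ModuleCat.ofHom f) (ModuleCat.ofHom g) (by
      ext x
      exact hfg.apply_apply_eq_zero x)
  have hS : S.ShortExact := by
    refine ShortComplex.ShortExact.mk' ?_ ?_ ?_
    · exact (ShortComplex.ShortExact.moduleCat_exact_iff_function_exact S).2 hfg
    · exact (ModuleCat.mono_iff_injective _).2 hf
    · exact (ModuleCat.epi_iff_surjective _).2 hg
  obtain ⟨δ, hδ⟩ := exists_delta_of_shortExact a i hS
  exact ⟨δ.hom, hδ⟩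

lemma subsingleton_succ_of_injective [Module.Injective R M] :
    Subsingleton (TopLC R a (i + 1) M) := by
  have : Injective (ModuleCat.of R M) := Module.injective_object_of_injective_module R M
  refine ⟨fun x y => ?_⟩
  have key : ∀ x : TopLC R a (i + 1) M, x = 0 := by
    intro x
    obtain ⟨n, y, rfl⟩ := exists_rep a (i + 1) (ModuleCat.of R M) x
    have := ModuleCat.subsingleton_of_isZero
      (isZero_extObj_of_injective i ((quotSystem a).obj n) (ModuleCat.of R M))
    rw [Subsingleton.elim y 0]
    exact _root_.map_zero (ι a (i + 1) n (ModuleCat.of R M)).hom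
  rw [key x, key y]

theorem exists_eval : ∃ ev : ∀ (M : Type) [AddCommGroup M] [Module R M], TopLC R a 0 M →ₗ[R] M,
    ∀ (M : Type) [AddCommGroup M] [Module R M],
      Function.Injective (ev M) ∧
      (∀ m : M, (∃ x, ev M x = m) ↔ ∃ n : ℕ, ∀ r ∈ a ^ n, r • m = 0) ∧
      ∀ (N : Type) [AddCommGroup N] [Module R N] (f : M →ₗ[R] N) (x : TopLC R a 0 M),
        ev N (map a 0 f x) = f (ev M x) := by
  let one : ∀ n : ℕᵒᵖ, (quotSystem a).obj n := fun n =>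
    (Ideal.Quotient.mk (a ^ n.unop) 1 : R ⧸ a ^ n.unop)
  let e : ∀ (M : ModuleCat.{0} R) (n : ℕᵒᵖ),
      ((linearYoneda R (ModuleCat.{0} R)).obj M).obj (op ((quotSystem a).obj n)) ⟶ M := fun M n =>
    ModuleCat.ofHom { toFun := fun h => ModuleCat.Hom.hom h (one n)
                      map_add' := fun _ _ => rfl
                      map_smul' := fun _ _ => rfl }
  have hone : ∀ {m n : ℕᵒᵖ} (g : m ⟶ n), ((quotSystem a).map g).hom (one m) = one n :=
    fun g => rfl
  have hD : ∀ M : ModuleCat.{0} R, ∃ ψ : (localCohomology a 0).obj M ⟶ M,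
      ∀ n, ι a 0 n M ≫ ψ = inv (homToExt _ M) ≫ e M n := by
    intro M
    refine exists_desc a 0 M M (fun n => inv (homToExt _ M) ≫ e M n) (fun {m n} g => ?_)
    rw [← cancel_epi (homToExt _ M), IsIso.hom_inv_id_assoc]
    ext h
    have h₁ := homToExt_pre ((quotSystem a).map g) M h
    have h₂ : ∀ z, (inv (homToExt ((quotSystem a).obj m) M)).hom ((homToExt _ M).hom z) = z :=
      fun z => congrArg (fun t => t.hom z) (IsIso.hom_inv_id (homToExt _ M))
    refine Eq.trans (congrArg (fun t => (e M m).hom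
      ((inv (homToExt ((quotSystem a).obj m) M)).hom t)) h₁) ?_
    refine Eq.trans (congrArg (e M m).hom (h₂ _)) ?_
    exact congrArg (ModuleCat.Hom.hom h) (hone g)
  choose ψ hψ using hD
  have hval : ∀ (M : ModuleCat.{0} R) (n : ℕᵒᵖ) (h : (quotSystem a).obj n ⟶ M),
      (ψ M).hom ((ι a 0 n M).hom ((homToExt _ M).hom h)) = h.hom (one n) := by
    intro M n h
    have h₂ : ∀ z, (inv (homToExt ((quotSystem a).obj n) M)).hom ((homToExt _ M).hom z) = z :=
      fun z => congrArg (fun t => t.hom z) (IsIso.hom_inv_id (homToExt _ M))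
    refine Eq.trans (congrArg (fun t => t.hom ((homToExt _ M).hom h)) (hψ M n)) ?_
    exact congrArg (e M n).hom (h₂ h)
  have hrep : ∀ (M : ModuleCat.{0} R) (x : (localCohomology a 0).obj M),
      ∃ (n : ℕᵒᵖ) (h : (quotSystem a).obj n ⟶ M), (ι a 0 n M).hom ((homToExt _ M).hom h) = x := by
    intro M x
    obtain ⟨n, y, rfl⟩ := exists_rep a 0 M x
    have h₂ : ∀ z, (homToExt _ M).hom ((inv (homToExt ((quotSystem a).obj n) M)).hom z) = z :=
      fun z => congrArg (fun t => t.hom z) (IsIso.inv_hom_id (homToExt _ M))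
    exact ⟨n, (inv (homToExt _ M)).hom y, by rw [h₂]⟩
  refine ⟨fun M _ _ => (ψ (ModuleCat.of R M)).hom, fun M _ _ => ⟨?_, ?_, ?_⟩⟩
  · refine (injective_iff_map_eq_zero _).2 fun x hx => ?_
    obtain ⟨n, h, rfl⟩ := hrep (ModuleCat.of R M) x
    have h₁ : h.hom (one n) = 0 := (hval (ModuleCat.of R M) n h).symm.trans hx
    have h₂ : h = 0 := by
      ext z
      obtain ⟨r, rfl⟩ := Ideal.Quotient.mk_surjective (I := a ^ n.unop) z
      have : (Ideal.Quotient.mk (a ^ n.unop) r : R ⧸ a ^ n.unop) =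
          r • (Ideal.Quotient.mk (a ^ n.unop) 1 : R ⧸ a ^ n.unop) := by
        rw [← Ideal.Quotient.mk_eq_mk, ← Ideal.Quotient.mk_eq_mk, ← Submodule.Quotient.mk_smul,
          smul_eq_mul, mul_one]
      refine Eq.trans (congrArg h.hom this) ?_
      refine Eq.trans (_root_.map_smul h.hom r (one n)) ?_
      rw [h₁, smul_zero]
      rfl
    rw [h₂]
    refine Eq.trans (congrArg _ (_root_.map_zero (homToExt _ (ModuleCat.of R M)).hom)) ?_
    exact _root_.map_zero (ι a 0 n (ModuleCat.of R M)).hom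
  · intro m
    constructor
    · rintro ⟨x, rfl⟩
      obtain ⟨n, h, rfl⟩ := hrep (ModuleCat.of R M) x
      refine ⟨n.unop, fun r hr => ?_⟩
      have : r • one n = 0 := by
        refine Eq.trans (b := (Ideal.Quotient.mk (a ^ n.unop) r : R ⧸ a ^ n.unop)) ?_ ?_
        · refine Eq.trans (b := r • (Ideal.Quotient.mk (a ^ n.unop) 1 : R ⧸ a ^ n.unop)) rfl ?_
          rw [← Ideal.Quotient.mk_eq_mk, ← Ideal.Quotient.mk_eq_mk, ← Submodule.Quotient.mk_smul,
            smul_eq_mul, mul_one]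
        · exact Ideal.Quotient.eq_zero_iff_mem.2 hr
      refine Eq.trans (congrArg (r • ·) (hval (ModuleCat.of R M) n h)) ?_
      refine Eq.trans (_root_.map_smul h.hom r (one n)).symm ?_
      rw [this]
      exact _root_.map_zero h.hom
    · rintro ⟨n, hn⟩
      let h : (quotSystem a).obj (op n) ⟶ ModuleCat.of R M := ModuleCat.ofHom
        (Submodule.liftQ (a ^ n) (LinearMap.toSpanSingleton R M m) (fun r hr => by
          simpa using hn r hr))
      refine ⟨(ι a 0 (op n) (ModuleCat.of R M)).hom ((homToExt _ _).hom h), ?_⟩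
      refine (hval (ModuleCat.of R M) (op n) h).trans ?_
      refine Eq.trans (Submodule.liftQ_apply (a ^ n) (LinearMap.toSpanSingleton R M m) 1) ?_
      simp
  · intro N _ _ f x
    obtain ⟨n, h, rfl⟩ := hrep (ModuleCat.of R M) x
    refine (congrArg (ψ (ModuleCat.of R N)).hom (map_ι a 0 n f _)).trans ?_
    refine (congrArg (fun t => (ψ (ModuleCat.of R N)).hom ((ι a 0 n (ModuleCat.of R N)).hom t))
      (homToExt_map _ (ModuleCat.ofHom f) h)).trans ?_
    refine (hval (ModuleCat.of R N) n _).trans ?_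
    exact congrArg f (hval (ModuleCat.of R M) n h).symm

end TopLC

namespace TopLC

section Basic

variable {R : Type} [CommRing R] (a : Ideal R) (i : ℕ)
  {M N L : Type} [AddCommGroup M] [Module R M] [AddCommGroup N] [Module R N]
  [AddCommGroup L] [Module R L]

/-- Local cohomology of isomorphic modules. -/
noncomputable def mapEquiv (e : M ≃ₗ[R] N) : TopLC R a i M ≃ₗ[R] TopLC R a i N :=
  LinearEquiv.ofLinearMap (map a i e.toLinearMap) (map a i e.symm.toLinearMap)
    (by rw [← map_comp]; simp [map_id]) (by rw [← map_comp]; simp [map_id])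

lemma subsingleton_of_subsingleton [Subsingleton M] : Subsingleton (TopLC R a i M) := by
  refine ⟨fun x y => ?_⟩
  have h : (LinearMap.id : M →ₗ[R] M) = 0 := LinearMap.ext fun m => Subsingleton.elim _ _
  have key : ∀ x : TopLC R a i M, x = 0 := fun x => by
    rw [← LinearMap.id_apply (R := R) x, ← map_id, h, TopLC.map_zero, LinearMap.zero_apply]
  rw [key x, key y]

/-- The canonical injection `H^0_a(M) → M`. -/
noncomputable def ev (M : Type) [AddCommGroup M] [Module R M] : TopLC R a 0 M →ₗ[R] M :=
  (exists_eval a).choose M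

lemma ev_injective : Function.Injective (ev a M) :=
  ((exists_eval a).choose_spec M).1

lemma ev_map (f : M →ₗ[R] N) (x : TopLC R a 0 M) : ev a N (map a 0 f x) = f (ev a M x) :=
  ((exists_eval a).choose_spec M).2.2 N f x

/-- The `a`-torsion submodule `Γ_a(M)`. -/
def torsion (M : Type) [AddCommGroup M] [Module R M] : Submodule R M where
  carrier := {m | ∃ n : ℕ, ∀ r ∈ a ^ n, r • m = 0}
  zero_mem' := ⟨0, fun r _ => smul_zero r⟩
  add_mem' := by
    rintro x y ⟨n, hn⟩ ⟨k, hk⟩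
    refine ⟨n + k, fun r hr => ?_⟩
    rw [smul_add, hn r (Ideal.pow_le_pow_right (Nat.le_add_right n k) hr),
      hk r (Ideal.pow_le_pow_right (Nat.le_add_left k n) hr), add_zero]
  smul_mem' := by
    rintro c x ⟨n, hn⟩
    exact ⟨n, fun r hr => by rw [smul_comm, hn r hr, smul_zero]⟩

lemma range_ev : LinearMap.range (ev a M) = torsion a M := by
  ext m
  exact ((exists_eval a).choose_spec M).2.1 m

/-- A module is `a`-torsion if every element is killed by a power of `a`. -/
def IsTors (M : Type) [AddCommGroup M] [Module R M] : Prop :=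
  ∀ m : M, ∃ n : ℕ, ∀ r ∈ a ^ n, r • m = 0

variable {a}

lemma IsTors.of_injective (h : IsTors a N) (f : M →ₗ[R] N) (hf : Function.Injective f) :
    IsTors a M := fun m => by
  obtain ⟨n, hn⟩ := h (f m)
  exact ⟨n, fun r hr => hf (by rw [map_smul, hn r hr, _root_.map_zero])⟩

lemma IsTors.of_surjective (h : IsTors a M) (f : M →ₗ[R] N) (hf : Function.Surjective f) :
    IsTors a N := fun m => by
  obtain ⟨m, rfl⟩ := hf m
  obtain ⟨n, hn⟩ := h m
  exact ⟨n, fun r hr => by rw [← _root_.map_smul, hn r hr, _root_.map_zero]⟩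

lemma isTors_torsion : IsTors a (torsion a M) := by
  rintro ⟨m, n, hn⟩
  exact ⟨n, fun r hr => Subtype.ext (hn r hr)⟩

lemma IsTors.torsion_eq_top (h : IsTors a M) : torsion a M = ⊤ :=
  top_le_iff.1 fun m _ => h m

/-- On torsion modules, `H^0_a` is the identity. -/
lemma IsTors.ev_surjective (h : IsTors a M) : Function.Surjective (ev a M) :=
  LinearMap.range_eq_top.1 ((range_ev a).trans h.torsion_eq_top)

lemma exists_injective_embedding (M : Type) [AddCommGroup M] [Module R M] :
    ∃ (I : Type) (_ : AddCommGroup I) (_ : Module R I), Module.Injective R I ∧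
      ∃ f : M →ₗ[R] I, Function.Injective f := by
  let I := Injective.under (ModuleCat.of R M)
  have : Injective (ModuleCat.of R I) := inferInstanceAs (Injective (Injective.under _))
  exact ⟨I, inferInstance, inferInstance, Module.injective_module_of_injective_object R I,
    (Injective.ι (ModuleCat.of R M)).hom, (ModuleCat.mono_iff_injective _).1 inferInstance⟩

variable (a)

theorem isTors : ∀ (i : ℕ) (M : Type) [AddCommGroup M] [Module R M], IsTors a (TopLC R a i M)
  | 0, M, _, _ => by
    have h : ∀ x, ev a M x ∈ torsion a M := fun x => range_ev a (M := M) ▸ ⟨x, rfl⟩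
    exact IsTors.of_injective isTors_torsion ((ev a M).codRestrict _ h)
      (fun x y hxy => ev_injective a (congrArg Subtype.val hxy))
  | i + 1, M, _, _ => by
    obtain ⟨I, _, _, _, f, hf⟩ := exists_injective_embedding (R := R) M
    obtain ⟨δ, -, -, h⟩ := exists_delta a i f (LinearMap.range f).mkQ hf
      (Submodule.mkQ_surjective _) (LinearMap.exact_map_mkQ_range f)
    have := subsingleton_succ_of_injective a i (M := I)
    exact (isTors i _).of_surjective δ fun x => (h x).1 (Subsingleton.elim _ _)

end Basic

section Noetherian

variable {R : Type} [CommRing R] [IsNoetherianRing R] (a : Ideal R)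

theorem injective_torsion (I : Type) [AddCommGroup I] [Module R I] [Module.Injective R I] :
    Module.Injective R (torsion a I) := by
  refine Module.Baer.injective fun J g => ?_
  obtain ⟨n, hn⟩ : ∃ n : ℕ, ∀ r ∈ a ^ n, ∀ j : J, r • g j = 0 := by
    obtain ⟨s, hs⟩ := (IsNoetherian.noetherian (⊤ : Submodule R J))
    choose k hk using fun j : J => isTors_torsion (a := a) (M := I) (g j)
    refine ⟨s.sup k, fun r hr j => ?_⟩
    have hj : j ∈ Submodule.span R (s : Set J) := hs ▸ Submodule.mem_top
    induction hj using Submodule.span_induction with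
    | mem x hx => exact hk x r (Ideal.pow_le_pow_right (Finset.le_sup hx) hr)
    | zero => simp
    | add x y _ _ hx hy => rw [map_add, smul_add, hx, hy, add_zero]
    | smul c x _ hx => rw [_root_.map_smul, smul_comm, hx, smul_zero]
  obtain ⟨k, hk⟩ := a.exists_pow_inf_eq_pow_smul J
  have hg : ∀ j : J, (j : R) ∈ a ^ (k + n) → g j = 0 := by
    have hk := hk (k + n) (Nat.le_add_right k n)
    intro j hj
    have h₁ : (j : R) ∈ a ^ (k + n) • (⊤ : Submodule R R) ⊓ J :=
      ⟨by simpa using hj, j.2⟩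
    rw [hk, Nat.add_sub_cancel_left] at h₁
    have h₂ : (a ^ n • (a ^ k • (⊤ : Submodule R R) ⊓ J)) ≤
        (LinearMap.ker g).map J.subtype := by
      refine Submodule.smul_le.2 fun r hr x hx => ?_
      exact ⟨r • ⟨x, hx.2⟩, (_root_.map_smul g r _).trans (hn r hr _), rfl⟩
    obtain ⟨j', hj', e⟩ := h₂ h₁
    rw [← Subtype.ext e]
    exact hj'
  let q : J →ₗ[R] R ⧸ a ^ (k + n) := (a ^ (k + n)).mkQ ∘ₗ J.subtype
  have hq : LinearMap.ker q ≤ LinearMap.ker ((torsion a I).subtype ∘ₗ g) := by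
    intro j hj
    have : g j = 0 := hg j ((Submodule.Quotient.mk_eq_zero _).1 hj)
    simp [this]
  let u : LinearMap.range q →ₗ[R] I :=
    (LinearMap.ker q).liftQ ((torsion a I).subtype ∘ₗ g) hq ∘ₗ q.quotKerEquivRange.symm.toLinearMap
  have hu : ∀ j, u ⟨q j, ⟨j, rfl⟩⟩ = g j := by
    intro j
    have : q.quotKerEquivRange.symm ⟨q j, ⟨j, rfl⟩⟩ = Submodule.Quotient.mk j := by
      rw [LinearEquiv.symm_apply_eq]
      rfl
    simp only [u, LinearMap.comp_apply, LinearEquiv.coe_coe, this]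
    rfl
  obtain ⟨h, hh⟩ := Module.Injective.out (LinearMap.range q).subtype
    (Submodule.subtype_injective _) u
  have hmem : ∀ z, h z ∈ torsion a I := by
    intro z
    refine ⟨k + n, fun r hr => ?_⟩
    obtain ⟨s, rfl⟩ := Submodule.Quotient.mk_surjective _ z
    rw [← _root_.map_smul, ← Submodule.Quotient.mk_smul,
      smul_eq_mul, (Submodule.Quotient.mk_eq_zero _).2 (Ideal.mul_mem_right s _ hr), _root_.map_zero]
  refine ⟨(h ∘ₗ (a ^ (k + n)).mkQ).codRestrict _ fun z => hmem _, fun x hx => ?_⟩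
  refine Subtype.ext ?_
  exact (hh ⟨q ⟨x, hx⟩, ⟨_, rfl⟩⟩).trans (hu ⟨x, hx⟩)

theorem exists_torsion_injective_embedding {M : Type} [AddCommGroup M] [Module R M]
    (h : IsTors a M) :
    ∃ (I : Type) (_ : AddCommGroup I) (_ : Module R I), Module.Injective R I ∧ IsTors a I ∧
      ∃ f : M →ₗ[R] I, Function.Injective f := by
  obtain ⟨I, _, _, _, f, hf⟩ := exists_injective_embedding (R := R) M
  refine ⟨torsion a I, inferInstance, inferInstance, injective_torsion a I, isTors_torsion,
    f.codRestrict _ fun m => ?_, fun x y hxy => hf (congrArg Subtype.val hxy)⟩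
  obtain ⟨n, hn⟩ := h m
  exact ⟨n, fun r hr => by rw [← _root_.map_smul, hn r hr, _root_.map_zero]⟩

theorem subsingleton_succ_of_isTors : ∀ (i : ℕ) (M : Type) [AddCommGroup M] [Module R M],
    IsTors a M → Subsingleton (TopLC R a (i + 1) M)
  | 0, M, _, _, h => by
    obtain ⟨I, _, _, _, hI, f, hf⟩ := exists_torsion_injective_embedding a h
    obtain ⟨δ, -, h₁, h₂⟩ := exists_delta a 0 f (LinearMap.range f).mkQ hf
      (Submodule.mkQ_surjective _) (LinearMap.exact_map_mkQ_range f)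
    have := subsingleton_succ_of_injective a 0 (M := I)
    have hδ : ∀ y, δ y = 0 := by
      intro y
      refine (h₁ y).2 ?_
      obtain ⟨z, hz⟩ := Submodule.mkQ_surjective (LinearMap.range f) (ev a _ y)
      obtain ⟨x, rfl⟩ := hI.ev_surjective z
      exact ⟨x, ev_injective a (by rw [ev_map, hz])⟩
    refine subsingleton_of_forall_eq 0 fun x => ?_
    obtain ⟨y, rfl⟩ := (h₂ x).1 (Subsingleton.elim _ _)
    exact hδ y
  | i + 1, M, _, _, h => by
    obtain ⟨I, _, _, _, hI, f, hf⟩ := exists_torsion_injective_embedding a h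
    obtain ⟨δ, -, -, h₂⟩ := exists_delta a (i + 1) f (LinearMap.range f).mkQ hf
      (Submodule.mkQ_surjective _) (LinearMap.exact_map_mkQ_range f)
    have := subsingleton_succ_of_injective a (i + 1) (M := I)
    have := subsingleton_succ_of_isTors i _ (hI.of_surjective _ (Submodule.mkQ_surjective
      (LinearMap.range f)))
    refine subsingleton_of_forall_eq 0 fun x => ?_
    obtain ⟨y, rfl⟩ := (h₂ x).1 (Subsingleton.elim _ _)
    rw [Subsingleton.elim y 0, _root_.map_zero]

end Noetherian

end TopLC

/-- Cokernels of isomorphic maps are isomorphic. -/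
lemma nonempty_equiv_of_exact {R A B C A' B' C' : Type*} [CommRing R]
    [AddCommGroup A] [Module R A] [AddCommGroup B] [Module R B] [AddCommGroup C] [Module R C]
    [AddCommGroup A'] [Module R A'] [AddCommGroup B'] [Module R B'] [AddCommGroup C'] [Module R C']
    {f : A →ₗ[R] B} {g : B →ₗ[R] C} {f' : A' →ₗ[R] B'} {g' : B' →ₗ[R] C'}
    (h : Function.Exact f g) (hg : Function.Surjective g)
    (h' : Function.Exact f' g') (hg' : Function.Surjective g')
    (eA : A ≃ₗ[R] A') (eB : B ≃ₗ[R] B') (comm : ∀ x, eB (f x) = f' (eA x)) :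
    Nonempty (C ≃ₗ[R] C') := by
  have key : (LinearMap.ker g).map eB.toLinearMap = LinearMap.ker g' := by
    rw [h.linearMap_ker_eq, h'.linearMap_ker_eq, ← LinearMap.range_comp]
    refine le_antisymm ?_ ?_
    · rintro _ ⟨x, rfl⟩
      exact ⟨eA x, (comm x).symm⟩
    · rintro _ ⟨x, rfl⟩
      exact ⟨eA.symm x, (comm _).trans (by rw [eA.apply_symm_apply])⟩
  exact ⟨(g.quotKerEquivOfSurjective hg).symm ≪≫ₗ Submodule.Quotient.equiv _ _ eB key ≪≫ₗ
    g'.quotKerEquivOfSurjective hg'⟩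

/-- A map which is exact with zero modules on both sides is an isomorphism. -/
lemma nonempty_equiv_of_exact_of_subsingleton {R A B C D : Type*} [CommRing R]
    [AddCommGroup A] [Module R A] [AddCommGroup B] [Module R B] [AddCommGroup C] [Module R C]
    [AddCommGroup D] [Module R D] [Subsingleton A] [Subsingleton D]
    {f : A →ₗ[R] B} {g : B →ₗ[R] C} {h : C →ₗ[R] D}
    (hfg : Function.Exact f g) (hgh : Function.Exact g h) : Nonempty (B ≃ₗ[R] C) :=
  ⟨LinearEquiv.ofBijective g ⟨(injective_iff_map_eq_zero g).2 fun x hx => by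
      obtain ⟨y, rfl⟩ := (hfg x).1 hx
      rw [Subsingleton.elim y 0, map_zero],
    fun x => (hgh x).1 (Subsingleton.elim _ _)⟩⟩

namespace TopLC

lemma exists_equiv_zero {R : Type} [CommRing R] {a b : Ideal R} {N : Type} [AddCommGroup N] [Module R N]
    (h : torsion a N = torsion b N) :
    ∃ e : TopLC R a 0 N ≃ₗ[R] TopLC R b 0 N, ∀ x, ev b N (e x) = ev a N x := by
  have h' : LinearMap.range (ev a N) = LinearMap.range (ev b N) := by rw [range_ev, range_ev, h]
  refine ⟨LinearEquiv.ofInjective _ (ev_injective a) ≪≫ₗ LinearEquiv.ofEq _ _ h' ≪≫ₗ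
    (LinearEquiv.ofInjective _ (ev_injective b)).symm, fun x => ?_⟩
  exact congrArg Subtype.val ((LinearEquiv.ofInjective _ (ev_injective b)).apply_symm_apply
    (LinearEquiv.ofEq _ _ h' (LinearEquiv.ofInjective _ (ev_injective a) x)))

section ChangeOfIdeals

variable {R : Type} [CommRing R] [IsNoetherianRing R] {a b J : Ideal R}

lemma torsion_le_of_isTors {N : Type} [AddCommGroup N] [Module R N] (hN : IsTors J N)
    (h : b ≤ (a ⊔ J).radical) : torsion a N ≤ torsion b N := by
  rintro m ⟨n, hn⟩
  obtain ⟨l, hl⟩ := hN m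
  obtain ⟨k, hk⟩ := Ideal.exists_pow_le_of_le_radical_of_fg h (IsNoetherian.noetherian b)
  refine ⟨k * (n + l), fun r hr => ?_⟩
  rw [pow_mul] at hr
  have hr' : r ∈ a ^ n ⊔ J ^ l :=
    Ideal.sup_pow_add_le_pow_sup_pow (Ideal.pow_right_mono hk _ hr)
  obtain ⟨x, hx, y, hy, rfl⟩ := Submodule.mem_sup.1 hr'
  rw [add_smul, hn x hx, hl y hy, add_zero]

lemma torsion_eq_of_isTors {N : Type} [AddCommGroup N] [Module R N] (hN : IsTors J N)
    (h : (a ⊔ J).radical = (b ⊔ J).radical) : torsion a N = torsion b N :=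
  le_antisymm (torsion_le_of_isTors hN (h ▸ le_sup_left.trans Ideal.le_radical))
    (torsion_le_of_isTors hN (h ▸ le_sup_left.trans Ideal.le_radical))

/-- On `J`-torsion modules, local cohomology with respect to `a` only depends on
`√(a + J)`. -/
theorem nonempty_equiv_of_radical_eq (h : (a ⊔ J).radical = (b ⊔ J).radical) :
    ∀ (i : ℕ) (N : Type) [AddCommGroup N] [Module R N], IsTors J N →
      Nonempty (TopLC R a i N ≃ₗ[R] TopLC R b i N)
  | 0, N, _, _, hN => ⟨(exists_equiv_zero (torsion_eq_of_isTors hN h)).choose⟩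
  | 1, N, _, _, hN => by
    obtain ⟨I, _, _, _, hI, f, hf⟩ := exists_torsion_injective_embedding J hN
    have hC : IsTors J (I ⧸ LinearMap.range f) := hI.of_surjective _ (Submodule.mkQ_surjective _)
    obtain ⟨δ, -, h₁, h₂⟩ := exists_delta a 0 f (LinearMap.range f).mkQ hf
      (Submodule.mkQ_surjective _) (LinearMap.exact_map_mkQ_range f)
    obtain ⟨δ', -, h₁', h₂'⟩ := exists_delta b 0 f (LinearMap.range f).mkQ hf
      (Submodule.mkQ_surjective _) (LinearMap.exact_map_mkQ_range f)
    have := subsingleton_succ_of_injective a 0 (M := I)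
    have := subsingleton_succ_of_injective b 0 (M := I)
    obtain ⟨e, he⟩ := exists_equiv_zero (torsion_eq_of_isTors hI h)
    obtain ⟨e', he'⟩ := exists_equiv_zero (torsion_eq_of_isTors hC h)
    refine nonempty_equiv_of_exact h₁ (fun x => (h₂ x).1 (Subsingleton.elim _ _))
      h₁' (fun x => (h₂' x).1 (Subsingleton.elim _ _)) e e' fun x => ev_injective b ?_
    rw [he', ev_map, ev_map, he]
  | i + 2, N, _, _, hN => by
    obtain ⟨I, _, _, _, hI, f, hf⟩ := exists_torsion_injective_embedding J hN
    have hC : IsTors J (I ⧸ LinearMap.range f) := hI.of_surjective _ (Submodule.mkQ_surjective _)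
    obtain ⟨δ, -, h₁, h₂⟩ := exists_delta a (i + 1) f (LinearMap.range f).mkQ hf
      (Submodule.mkQ_surjective _) (LinearMap.exact_map_mkQ_range f)
    obtain ⟨δ', -, h₁', h₂'⟩ := exists_delta b (i + 1) f (LinearMap.range f).mkQ hf
      (Submodule.mkQ_surjective _) (LinearMap.exact_map_mkQ_range f)
    have := subsingleton_succ_of_injective a i (M := I)
    have := subsingleton_succ_of_injective b i (M := I)
    have := subsingleton_succ_of_injective a (i + 1) (M := I)
    have := subsingleton_succ_of_injective b (i + 1) (M := I)
    obtain ⟨e₁⟩ := nonempty_equiv_of_exact_of_subsingleton h₁ h₂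
    obtain ⟨e₂⟩ := nonempty_equiv_of_exact_of_subsingleton h₁' h₂'
    obtain ⟨e⟩ := nonempty_equiv_of_radical_eq h (i + 1) _ hC
    exact ⟨e₁.symm ≪≫ₗ e ≪≫ₗ e₂⟩

end ChangeOfIdeals

end TopLC

namespace TopLC

theorem subsingleton_of_sum_smul_eq {R : Type} [CommRing R] (a : Ideal R) (i : ℕ) {N : Type}
    [AddCommGroup N] [Module R N] {ι : Type} [Fintype ι] (x : ι → R) (hx : ∀ j, x j ∈ a)
    (h : ι → N →ₗ[R] N) (hh : ∀ n, ∑ j, x j • h j n = n) : Subsingleton (TopLC R a i N) := by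
  have key : ∀ ξ : TopLC R a i N, ∑ j, map a i (h j) (x j • ξ) = ξ := by
    intro ξ
    have h₁ : (∑ j, x j • h j : N →ₗ[R] N) = LinearMap.id := by
      ext n
      simpa using hh n
    have h₂ := congrArg (fun g => g ξ) ((congrArg (map a i) h₁).trans (map_id a i))
    rw [TopLC.map_sum] at h₂
    simp only [LinearMap.sum_apply, TopLC.map_smul, LinearMap.smul_apply, LinearMap.id_apply] at h₂
    simpa only [_root_.map_smul] using h₂
  have : ∀ (n : ℕ) (ξ : TopLC R a i N), (∀ r ∈ a ^ n, r • ξ = 0) → ξ = 0 := by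
    intro n
    induction n with
    | zero => exact fun ξ hξ => by simpa using hξ 1 (by simp)
    | succ n ih =>
      intro ξ hξ
      rw [← key ξ]
      refine Finset.sum_eq_zero fun j _ => ?_
      rw [ih (x j • ξ) fun r hr => ?_, _root_.map_zero]
      rw [← mul_smul]
      exact hξ _ (pow_succ a n ▸ Ideal.mul_mem_mul hr (hx j))
  refine subsingleton_of_forall_eq 0 fun ξ => ?_
  obtain ⟨n, hn⟩ := isTors a i N ξ
  exact this n ξ hn

section FlatBaseChange

variable {A : Type} [CommRing A] (T : Type) [CommRing T] [Algebra A T] (a : Ideal A)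

lemma IsTors.baseChange {a : Ideal A} {N : Type} [AddCommGroup N] [Module A N] (h : IsTors a N) :
    IsTors (a.map (algebraMap A T)) (T ⊗[A] N) := by
  intro y
  change y ∈ torsion _ _
  induction y with
  | zero => exact zero_mem _
  | add x y hx hy => exact add_mem hx hy
  | tmul t n =>
    obtain ⟨k, hk⟩ := h n
    refine ⟨k, fun r hr => ?_⟩
    rw [← Ideal.map_pow] at hr
    induction hr using Submodule.span_induction with
    | mem x hx =>
      obtain ⟨s, hs, rfl⟩ := hx
      rw [algebraMap_smul, ← TensorProduct.tmul_smul, hk s hs, TensorProduct.tmul_zero]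
    | zero => exact zero_smul _ _
    | add x y _ _ hx hy => rw [add_smul, hx, hy, add_zero]
    | smul c x _ hx => rw [smul_assoc, hx, smul_zero]

theorem subsingleton_baseChange_of_torsion_eq_bot [IsNoetherianRing A] (i : ℕ) {I : Type}
    [AddCommGroup I] [Module A I] [Module.Injective A I] (h : torsion a I = ⊥) :
    Subsingleton (TopLC T (a.map (algebraMap A T)) i (T ⊗[A] I)) := by
  classical
  obtain ⟨s, hs⟩ := IsNoetherian.noetherian a
  let X : I →ₗ[A] (s → I) := LinearMap.pi fun r => LinearMap.lsmul A I r
  have hX : Function.Injective X := (injective_iff_map_eq_zero X).2 fun m hm => by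
    have hm' : m ∈ torsion a I := by
      refine ⟨1, fun r hr => ?_⟩
      rw [pow_one, ← hs] at hr
      induction hr using Submodule.span_induction with
      | mem x hx => simpa [X] using congrFun hm ⟨x, hx⟩
      | zero => exact zero_smul _ _
      | add x y _ _ hx hy => rw [add_smul, hx, hy, add_zero]
      | smul c x _ hx => rw [smul_assoc, hx, smul_zero]
    rwa [h] at hm'
  obtain ⟨Y, hY⟩ := Module.Injective.out X hX LinearMap.id
  refine subsingleton_of_sum_smul_eq _ i (fun r : s => algebraMap A T r)
    (fun r => Ideal.mem_map_of_mem _ (hs ▸ Submodule.subset_span r.2))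
    (fun r => (Y ∘ₗ LinearMap.single A (fun _ : s => I) r).baseChange T) fun y => ?_
  induction y with
  | zero => simp
  | add x y hx hy => simp only [_root_.map_add, smul_add, Finset.sum_add_distrib, hx, hy]
  | tmul t m =>
    have h₁ : ∑ r : s, (r : A) • Y (Pi.single r m) = m := by
      conv_rhs => rw [← LinearMap.id_apply (R := A) m, ← hY m]
      rw [← Finset.univ_sum_single (X m), _root_.map_sum]
      refine Finset.sum_congr rfl fun r _ => ?_
      rw [← _root_.map_smul]
      congr 1
      funext k
      by_cases hk : k = r
      · subst hk; simp [X]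
      · simp [hk, X]
    conv_rhs => rw [← h₁, TensorProduct.tmul_sum]
    refine Finset.sum_congr rfl fun r _ => ?_
    rw [algebraMap_smul, LinearMap.baseChange_tmul, TensorProduct.tmul_smul]
    rfl

variable [Module.Flat A T]

lemma mem_range_baseChange_of_smul_eq_zero {N : Type} [AddCommGroup N] [Module A N]
    (s : Finset A) (y : T ⊗[A] N) (hy : ∀ r ∈ s, r • y = 0) (K : Submodule A N)
    (hK : ∀ n, (∀ r ∈ s, r • n = 0) → n ∈ K) :
    y ∈ LinearMap.range (K.subtype.baseChange T) := by
  classical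
  let X : N →ₗ[A] (s → N) := LinearMap.pi fun r => LinearMap.lsmul A N r
  have hX : Function.Exact (LinearMap.ker X).subtype X := LinearMap.exact_subtype_ker_map X
  have hXT := Module.Flat.lTensor_exact T hX
  have h0 : X.lTensor T y = 0 := by
    refine (TensorProduct.piRight A A T fun _ : s => N).injective ?_
    rw [_root_.map_zero]
    funext r
    have : ∀ z : T ⊗[A] N, TensorProduct.piRight A A T (fun _ : s => N) (X.lTensor T z) r =
        (r : A) • z := by
      intro z
      induction z with
      | zero => simp
      | add x y hx hy => simp only [_root_.map_add, Pi.add_apply, hx, hy, smul_add]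
      | tmul t n => simp [X]
    rw [this, hy r r.2, Pi.zero_apply]
  obtain ⟨z, rfl⟩ := (hXT y).1 h0
  have hle : LinearMap.ker X ≤ K := fun n hn => hK n fun r hr => by
    simpa [X] using congrFun (LinearMap.mem_ker.1 hn) ⟨r, hr⟩
  refine ⟨(Submodule.inclusion hle).baseChange T z, ?_⟩
  rw [← LinearMap.comp_apply, ← LinearMap.baseChange_comp]
  rfl

variable [IsNoetherianRing A]

theorem range_baseChange_torsion (N : Type) [AddCommGroup N] [Module A N] :
    LinearMap.range ((torsion a N).subtype.baseChange T) =
      torsion (a.map (algebraMap A T)) (T ⊗[A] N) := by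
  refine le_antisymm ?_ ?_
  · rintro _ ⟨y, rfl⟩
    obtain ⟨n, hn⟩ := isTors_torsion.baseChange (a := a) T y
    exact ⟨n, fun r hr => by rw [← _root_.map_smul, hn r hr, _root_.map_zero]⟩
  · rintro y ⟨n, hn⟩
    obtain ⟨s, hs⟩ := IsNoetherian.noetherian (a ^ n)
    refine mem_range_baseChange_of_smul_eq_zero T s y (fun r hr => ?_) _ fun m hm => ⟨n, ?_⟩
    · rw [← algebraMap_smul T r y]
      refine hn _ ?_
      rw [← Ideal.map_pow]
      exact Ideal.mem_map_of_mem _ (hs ▸ Submodule.subset_span hr)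
    · intro r hr
      rw [← hs] at hr
      induction hr using Submodule.span_induction with
      | mem x hx => exact hm x hx
      | zero => exact zero_smul _ _
      | add x y _ _ hx hy => rw [add_smul, hx, hy, add_zero]
      | smul c x _ hx => rw [smul_assoc, hx, smul_zero]

theorem exists_equiv_baseChange_zero (N : Type) [AddCommGroup N] [Module A N] :
    ∃ e : T ⊗[A] TopLC A a 0 N ≃ₗ[T] TopLC T (a.map (algebraMap A T)) 0 (T ⊗[A] N),
      ∀ x, ev _ _ (e x) = (ev a N).baseChange T x := by
  have hinj : Function.Injective ((ev a N).baseChange T) :=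
    Module.Flat.lTensor_preserves_injective_linearMap (M := T) (ev a N) (ev_injective a)
  have hr : LinearMap.range ((ev a N).baseChange T) =
      LinearMap.range (ev (a.map (algebraMap A T)) (T ⊗[A] N)) := by
    rw [range_ev, ← range_baseChange_torsion]
    have hm : ∀ x, ev a N x ∈ torsion a N := fun x => range_ev a (M := N) ▸ ⟨x, rfl⟩
    let u : TopLC A a 0 N →ₗ[A] torsion a N := (ev a N).codRestrict _ hm
    have hu : Function.Surjective u := by
      rintro ⟨m, hm⟩
      rw [← range_ev] at hm
      obtain ⟨x, rfl⟩ := hm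
      exact ⟨x, rfl⟩
    have h₁ : (ev a N).baseChange T = (torsion a N).subtype.baseChange T ∘ₗ u.baseChange T := by
      rw [← LinearMap.baseChange_comp]
      rfl
    rw [h₁, LinearMap.range_comp_of_range_eq_top]
    exact LinearMap.range_eq_top.2 (LinearMap.lTensor_surjective T hu)
  refine ⟨LinearEquiv.ofInjective _ hinj ≪≫ₗ LinearEquiv.ofEq _ _ hr ≪≫ₗ
    (LinearEquiv.ofInjective _ (ev_injective _)).symm, fun x => ?_⟩
  exact congrArg Subtype.val ((LinearEquiv.ofInjective _ (ev_injective _)).apply_symm_apply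
    (LinearEquiv.ofEq _ _ hr (LinearEquiv.ofInjective _ hinj x)))

/-- A retract of an injective module is injective. -/
lemma injective_of_leftInverse {A I J : Type} [CommRing A] [AddCommGroup I] [Module A I]
    [AddCommGroup J] [Module A J] [Module.Injective A I] (σ : J →ₗ[A] I) (π : I →ₗ[A] J)
    (h : ∀ x, π (σ x) = x) : Module.Injective A J :=
  ⟨fun _ _ _ _ _ _ f hf g => by
    obtain ⟨u, hu⟩ := Module.Injective.out f hf (σ ∘ₗ g)
    exact ⟨π ∘ₗ u, fun x => by rw [LinearMap.comp_apply, hu, LinearMap.comp_apply, h]⟩⟩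

lemma injective_quotient_torsion (I : Type) [AddCommGroup I] [Module A I] [Module.Injective A I] :
    Module.Injective A (I ⧸ torsion a I) ∧ torsion a (I ⧸ torsion a I) = ⊥ := by
  have := injective_torsion a I
  obtain ⟨ρ, hρ⟩ := Module.Injective.out (torsion a I).subtype
    (Submodule.subtype_injective _) LinearMap.id
  let σ : (I ⧸ torsion a I) →ₗ[A] I :=
    (torsion a I).liftQ (LinearMap.id - (torsion a I).subtype ∘ₗ ρ) fun x hx => by
      have := congrArg Subtype.val (hρ ⟨x, hx⟩)
      simp only [Submodule.subtype_apply, LinearMap.id_apply] at this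
      simp [this]
  have hσ : ∀ x, (torsion a I).mkQ (σ x) = x := by
    intro x
    obtain ⟨x, rfl⟩ := Submodule.mkQ_surjective _ x
    refine (Submodule.Quotient.eq _).2 ?_
    change x - ((ρ x : torsion a I) : I) - x ∈ _
    rw [sub_sub_cancel_left]
    exact neg_mem (ρ x).2
  refine ⟨injective_of_leftInverse σ _ hσ, eq_bot_iff.2 ?_⟩
  rintro x ⟨n, hn⟩
  have : σ x ∈ torsion a I :=
    ⟨n, fun r hr => by rw [← _root_.map_smul, hn r hr, _root_.map_zero]⟩
  rw [← hσ x]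
  exact (Submodule.Quotient.mk_eq_zero _).2 this

variable [IsNoetherianRing T]

theorem subsingleton_baseChange_of_injective (i : ℕ) (I : Type) [AddCommGroup I] [Module A I]
    [Module.Injective A I] :
    Subsingleton (TopLC T (a.map (algebraMap A T)) (i + 1) (T ⊗[A] I)) := by
  obtain ⟨h₁, h₂⟩ := injective_quotient_torsion a I
  have s₁ := subsingleton_baseChange_of_torsion_eq_bot T a (i + 1) h₂
  have s₂ := subsingleton_succ_of_isTors (a.map (algebraMap A T)) i _
    (isTors_torsion.baseChange (a := a) (N := torsion a I) T)
  obtain ⟨-, h, -⟩ := exists_delta (a.map (algebraMap A T)) (i + 1)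
    ((torsion a I).subtype.baseChange T) ((torsion a I).mkQ.baseChange T)
    (Module.Flat.lTensor_preserves_injective_linearMap (M := T) _ (Submodule.subtype_injective _))
    (LinearMap.lTensor_surjective T (Submodule.mkQ_surjective _))
    (lTensor_exact T (LinearMap.exact_subtype_mkQ _) (Submodule.mkQ_surjective _))
  refine subsingleton_of_forall_eq 0 fun x => ?_
  obtain ⟨y, rfl⟩ := (h x).1 (Subsingleton.elim _ _)
  rw [Subsingleton.elim y 0, _root_.map_zero]

/-- Flat base change for local cohomology. -/
theorem nonempty_equiv_baseChange : ∀ (i : ℕ) (N : Type) [AddCommGroup N] [Module A N],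
    Nonempty (T ⊗[A] TopLC A a i N ≃ₗ[T] TopLC T (a.map (algebraMap A T)) i (T ⊗[A] N))
  | 0, N, _, _ => ⟨(exists_equiv_baseChange_zero T a N).choose⟩
  | 1, N, _, _ => by
    obtain ⟨I, _, _, _, f, hf⟩ := exists_injective_embedding (R := A) N
    obtain ⟨δ, -, h₁, h₂⟩ := exists_delta a 0 f (LinearMap.range f).mkQ hf
      (Submodule.mkQ_surjective _) (LinearMap.exact_map_mkQ_range f)
    obtain ⟨δ', -, h₁', h₂'⟩ := exists_delta (a.map (algebraMap A T)) 0
      (f.baseChange T) ((LinearMap.range f).mkQ.baseChange T)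
      (Module.Flat.lTensor_preserves_injective_linearMap (M := T) _ hf)
      (LinearMap.lTensor_surjective T (Submodule.mkQ_surjective _))
      (lTensor_exact T (LinearMap.exact_map_mkQ_range f) (Submodule.mkQ_surjective _))
    have := subsingleton_succ_of_injective a 0 (M := I)
    have := subsingleton_baseChange_of_injective T a 0 I
    have hδ : Function.Surjective δ := fun x => (h₂ x).1 (Subsingleton.elim _ _)
    obtain ⟨e, he⟩ := exists_equiv_baseChange_zero T a I
    obtain ⟨e', he'⟩ := exists_equiv_baseChange_zero T a (I ⧸ LinearMap.range f)
    refine nonempty_equiv_of_exact (f := (map a 0 (LinearMap.range f).mkQ).baseChange T)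
      (g := δ.baseChange T) (lTensor_exact T h₁ hδ) (LinearMap.lTensor_surjective T hδ)
      h₁' (fun x => (h₂' x).1 (Subsingleton.elim _ _)) e e' fun x => ev_injective _ ?_
    rw [he', ev_map, he]
    simp only [← LinearMap.comp_apply, ← LinearMap.baseChange_comp]
    congr 2
    exact LinearMap.ext fun z => ev_map a _ z
  | i + 2, N, _, _ => by
    obtain ⟨I, _, _, _, f, hf⟩ := exists_injective_embedding (R := A) N
    obtain ⟨δ, -, h₁, h₂⟩ := exists_delta a (i + 1) f (LinearMap.range f).mkQ hf
      (Submodule.mkQ_surjective _) (LinearMap.exact_map_mkQ_range f)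
    obtain ⟨δ', -, h₁', h₂'⟩ := exists_delta (a.map (algebraMap A T)) (i + 1)
      (f.baseChange T) ((LinearMap.range f).mkQ.baseChange T)
      (Module.Flat.lTensor_preserves_injective_linearMap (M := T) _ hf)
      (LinearMap.lTensor_surjective T (Submodule.mkQ_surjective _))
      (lTensor_exact T (LinearMap.exact_map_mkQ_range f) (Submodule.mkQ_surjective _))
    have := subsingleton_succ_of_injective a i (M := I)
    have := subsingleton_succ_of_injective a (i + 1) (M := I)
    have := subsingleton_baseChange_of_injective T a i I
    have := subsingleton_baseChange_of_injective T a (i + 1) I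
    obtain ⟨e₁⟩ := nonempty_equiv_of_exact_of_subsingleton h₁ h₂
    obtain ⟨e₂⟩ := nonempty_equiv_of_exact_of_subsingleton h₁' h₂'
    obtain ⟨e⟩ := nonempty_equiv_baseChange (i + 1) (I ⧸ LinearMap.range f)
    exact ⟨e₁.symm.baseChange A T _ _ ≪≫ₗ e ≪≫ₗ e₂⟩

end FlatBaseChange

end TopLC

/-- If `x` acts locally nilpotently on `H` and `0 :_H x` is Artinian, then so is `H`. -/
theorem isArtinian_of_isArtinian_ker_lsmul {R H : Type*} [CommRing R] [AddCommGroup H] [Module R H]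
    (x : R) (hx : ∀ h : H, ∃ n : ℕ, x ^ n • h = 0)
    [IsArtinian R (LinearMap.ker (LinearMap.lsmul R H x))] : IsArtinian R H := by
  refine monotone_stabilizes_iff_artinian.1 fun f => ?_
  let N : ℕ → Submodule R H := fun k => OrderDual.ofDual (f k)
  have hN : ∀ k l, k ≤ l → N l ≤ N k := fun k l h => f.monotone h
  let K := LinearMap.ker (LinearMap.lsmul R H x)
  let L : ℕ → ℕ → Submodule R K := fun k n =>
    ((N k).map (LinearMap.lsmul R H (x ^ n))).comap K.subtype
  have hL₁ : ∀ k l n, k ≤ l → L l n ≤ L k n := fun k l n h =>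
    Submodule.comap_mono (Submodule.map_mono (hN k l h))
  have hL₂ : ∀ k n m, n ≤ m → L k m ≤ L k n := by
    rintro k n m h z ⟨y, hy, e⟩
    refine ⟨x ^ (m - n) • y, (N k).smul_mem _ hy, ?_⟩
    rw [← e]
    simp only [LinearMap.lsmul_apply, ← mul_smul, ← pow_add, Nat.add_sub_cancel' h]
  have hstab : ∀ g : ℕ → Submodule R K, (∀ k l, k ≤ l → g l ≤ g k) →
      ∃ k, ∀ l, k ≤ l → g l = g k := fun g hg => by
    obtain ⟨k, hk⟩ := monotone_stabilizes_iff_artinian.2 ‹IsArtinian R K›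
      ⟨fun n => OrderDual.toDual (g n), fun k l h => hg k l h⟩
    exact ⟨k, fun l hl => (hk l hl).symm⟩
  choose κ hκ using fun n => hstab (fun k => L k n) fun k l h => hL₁ k l n h
  obtain ⟨k₀, hk₀⟩ := hstab (fun k => L k k) fun k l h => (hL₁ k l l h).trans (hL₂ k k l h)
  have key : ∀ n k, max k₀ ((Finset.range k₀).sup κ) ≤ k →
      L (max k₀ ((Finset.range k₀).sup κ)) n ≤ L k n := by
    intro n k hk
    by_cases hn : n < k₀
    · have h₁ : κ n ≤ max k₀ ((Finset.range k₀).sup κ) :=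
        (Finset.le_sup (f := κ) (Finset.mem_range.2 hn)).trans (le_max_right _ _)
      exact ((hκ n _ h₁).trans (hκ n _ (h₁.trans hk)).symm).le
    · have hn : k₀ ≤ n := not_lt.1 hn
      have h₁ : k₀ ≤ max k n := hn.trans (le_max_right _ _)
      calc L _ n ≤ L k₀ k₀ := (hL₁ _ _ _ (le_max_left _ _)).trans (hL₂ _ _ _ hn)
        _ = L (max k n) (max k n) := (hk₀ _ h₁).symm
        _ ≤ L k n := (hL₁ _ _ _ (le_max_left _ _)).trans (hL₂ _ _ _ (le_max_right _ _))
  refine ⟨max k₀ ((Finset.range k₀).sup κ), fun k hk => ?_⟩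
  refine le_antisymm (hN _ _ hk) ?_
  have : ∀ m : ℕ, ∀ y ∈ N (max k₀ ((Finset.range k₀).sup κ)), x ^ m • y = 0 → y ∈ N k := by
    intro m
    induction m with
    | zero =>
      intro y _ h0
      rw [pow_zero, one_smul] at h0
      exact h0 ▸ zero_mem _
    | succ m ih =>
      intro y hy h0
      have hz : x ^ m • y ∈ K := by
        rw [LinearMap.mem_ker, LinearMap.lsmul_apply, ← mul_smul, ← pow_succ', h0]
      obtain ⟨y', hy', e⟩ := key m k hk (show (⟨x ^ m • y, hz⟩ : K) ∈ _ from ⟨y, hy, rfl⟩)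
      have h₁ := ih (y - y') (sub_mem hy (hN _ _ hk hy')) (by
        rw [smul_sub, sub_eq_zero]
        exact e.symm)
      rw [← sub_add_cancel y y']
      exact add_mem h₁ hy'
  intro y hy
  obtain ⟨m, hm⟩ := hx y
  exact this m y hy hm

/-- A finitely generated module of dimension at most zero over a Noetherian ring is Artinian. -/
theorem isArtinian_of_supportDim_lt_one {R M : Type*} [CommRing R] [IsNoetherianRing R]
    [AddCommGroup M] [Module R M] [Module.Finite R M] (h : Module.supportDim R M < 1) :
    IsArtinian R M := by
  rw [Module.supportDim_eq_ringKrullDim_quotient_annihilator] at h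
  have h₁ : Ring.KrullDimLE 0 (R ⧸ Module.annihilator R M) := by
    rw [Ring.krullDimLE_iff]
    exact ENat.WithBot.lt_add_one_iff.1 (by simpa using h)
  have : IsArtinianRing (R ⧸ Module.annihilator R M) :=
    isArtinianRing_iff_isNoetherianRing_krullDimLE_zero.2 ⟨inferInstance, h₁⟩
  let := Module.quotientAnnihilator (R := R) (M := M)
  have : IsScalarTower R (R ⧸ Module.annihilator R M) M :=
    IsScalarTower.of_algebraMap_smul fun r m => rfl
  have : Module.Finite (R ⧸ Module.annihilator R M) M :=
    Module.Finite.of_restrictScalars_finite R _ M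
  exact isArtinian_of_surjective_algebraMap (R := R ⧸ Module.annihilator R M)
    Ideal.Quotient.mk_surjective

lemma supportDim_le_of_annihilator_le {R M N : Type*} [CommRing R]
    [AddCommGroup M] [Module R M] [Module.Finite R M] [AddCommGroup N] [Module R N]
    [Module.Finite R N] (h : Module.annihilator R M ≤ Module.annihilator R N) :
    Module.supportDim R N ≤ Module.supportDim R M := by
  rw [Module.supportDim_eq_ringKrullDim_quotient_annihilator,
    Module.supportDim_eq_ringKrullDim_quotient_annihilator]
  exact ringKrullDim_le_of_surjective (Ideal.Quotient.factor h)
    (Ideal.Quotient.factor_surjective h)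

namespace TopLC

section Top

lemma supportDim_quotSMulTop_lt {R M : Type} [CommRing R] [AddCommGroup M] [Module R M] [Module.Finite R M]
    {x : R} (hx : IsSMulRegular M x) {d : ℕ} (h : Module.supportDim R M < (d + 1 : ℕ)) :
    Module.supportDim R (QuotSMulTop x M) < d := by
  have h₁ := (Module.supportDim_quotSMulTop_succ_le_of_notMem_minimalPrimes
    fun p hp => hx.notMem_of_mem_minimalPrimes hp).trans_lt h
  rw [Nat.cast_add, Nat.cast_one] at h₁
  exact lt_of_add_lt_add_right h₁

open scoped Pointwise in
/-- Multiplication by a regular element `x ∈ a`: the long exact sequence relates `H^i(M / xM)`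
to the kernel of `x` on `H^(i+1)(M)`. -/
lemma exists_ker_lsmul_surjective {R M : Type} [CommRing R] (a : Ideal R) (i : ℕ) [AddCommGroup M] [Module R M] {x : R}
    (hx : IsSMulRegular M x) :
    ∃ δ : TopLC R a i (QuotSMulTop x M) →ₗ[R]
      LinearMap.ker (LinearMap.lsmul R (TopLC R a (i + 1) M) x), Function.Surjective δ := by
  have hex : Function.Exact (LinearMap.lsmul R M x) (x • (⊤ : Submodule R M)).mkQ := by
    intro m
    rw [← LinearMap.mem_ker, Submodule.ker_mkQ]
    exact ⟨fun ⟨y, _, e⟩ => ⟨y, e⟩, fun ⟨y, e⟩ => ⟨y, trivial, e⟩⟩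
  obtain ⟨δ, -, -, h⟩ := exists_delta a i (LinearMap.lsmul R M x) (x • (⊤ : Submodule R M)).mkQ
    hx (Submodule.mkQ_surjective _) hex
  have hm : map a (i + 1) (LinearMap.lsmul R M x) = LinearMap.lsmul R _ x := by
    have : LinearMap.lsmul R M x = x • LinearMap.id := rfl
    rw [this, TopLC.map_smul, map_id]
    rfl
  rw [hm] at h
  refine ⟨δ.codRestrict _ fun y => (h _).2 ⟨y, rfl⟩, fun ⟨z, hz⟩ => ?_⟩
  obtain ⟨y, rfl⟩ := (h z).1 hz
  exact ⟨y, rfl⟩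

theorem exact_map_subtype_map_mkQ {R M : Type} [CommRing R] [AddCommGroup M] [Module R M]
    (a : Ideal R) (i : ℕ) (K : Submodule R M) :
    Function.Exact (map a i K.subtype) (map a i K.mkQ) :=
  (exists_delta a i K.subtype K.mkQ (Submodule.subtype_injective _) (Submodule.mkQ_surjective _)
    (LinearMap.exact_subtype_mkQ _)).choose_spec.1

variable {R : Type} [CommRing R] [IsNoetherianRing R] (a : Ideal R)

lemma torsion_quotient_torsion (M : Type) [AddCommGroup M] [Module R M] :
    torsion a (M ⧸ torsion a M) = ⊥ := by
  refine eq_bot_iff.2 fun x => ?_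
  obtain ⟨x, rfl⟩ := Submodule.mkQ_surjective _ x
  rintro ⟨n, hn⟩
  obtain ⟨s, hs⟩ := IsNoetherian.noetherian (a ^ n)
  have h : ∀ r ∈ s, r • x ∈ torsion a M := fun r hr => by
    refine (Submodule.Quotient.mk_eq_zero _).1 ?_
    exact hn r (hs ▸ Submodule.subset_span hr)
  choose! k hk using h
  refine (Submodule.Quotient.mk_eq_zero _).2 ⟨s.sup k + n, fun r hr => ?_⟩
  rw [pow_add] at hr
  refine Submodule.mul_induction_on hr (fun u hu v hv => ?_) fun u v hu hv => by
    rw [add_smul, hu, hv, add_zero]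
  rw [← hs] at hv
  induction hv using Submodule.span_induction with
  | mem v hv =>
    rw [mul_smul]
    exact hk v hv u (Ideal.pow_le_pow_right (Finset.le_sup hv) hu)
  | zero => rw [mul_zero, zero_smul]
  | add v w _ _ hv hw => rw [mul_add, add_smul, hv, hw, add_zero]
  | smul c v _ hv => rw [smul_eq_mul, mul_left_comm, mul_smul, hv, smul_zero]

lemma exists_isSMulRegular {M : Type} [AddCommGroup M] [Module R M] [Module.Finite R M]
    (h : torsion a M = ⊥) : ∃ x ∈ a, IsSMulRegular M x := by
  by_contra! hc
  have hfin := associatedPrimes.finite R M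
  have h₁ : (a : Set R) ⊆ ⋃ p ∈ (hfin.toFinset : Set (Ideal R)), p := by
    intro x hx
    have h₂ : x ∈ {r : R | ∃ m : M, m ≠ 0 ∧ r • m = 0} := by
      by_contra hx'
      refine hc x hx ((isSMulRegular_iff_right_eq_zero_of_smul).2 fun m hm => ?_)
      by_contra hm0
      exact hx' ⟨m, hm0, hm⟩
    rw [← biUnion_associatedPrimes_eq_zero_divisors] at h₂
    simpa using h₂
  obtain ⟨p, hp, hap⟩ := (Ideal.subset_union_prime (f := id) (⊥ : Ideal R) ⊥
    fun p hp _ _ => ((hfin.mem_toFinset).1 hp).isPrime).1 h₁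
  obtain ⟨hp, m, rfl⟩ := (isAssociatedPrime_iff (R := R) (M := M)).1 ((hfin.mem_toFinset).1 hp)
  have hm : m ∈ torsion a M := ⟨1, fun r hr => by
    rw [pow_one] at hr
    simpa [Submodule.mem_colon_singleton] using hap hr⟩
  rw [h, Submodule.mem_bot] at hm
  exact hp.ne_top (by simp [hm])

lemma map_mkQ_torsion_injective (i : ℕ) (M : Type) [AddCommGroup M] [Module R M] :
    Function.Injective (map a (i + 1) (torsion a M).mkQ) := by
  obtain ⟨-, h, -⟩ := exists_delta a (i + 1) (torsion a M).subtype (torsion a M).mkQ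
    (Submodule.subtype_injective _) (Submodule.mkQ_surjective _) (LinearMap.exact_subtype_mkQ _)
  have := subsingleton_succ_of_isTors a i _ (isTors_torsion (a := a) (M := M))
  refine (injective_iff_map_eq_zero _).2 fun x hx => ?_
  obtain ⟨y, rfl⟩ := (h x).1 hx
  rw [Subsingleton.elim y 0, _root_.map_zero]

/-- Grothendieck's vanishing theorem. -/
theorem subsingleton_of_supportDim_lt : ∀ (d : ℕ) (M : Type) [AddCommGroup M] [Module R M]
    [Module.Finite R M], Module.supportDim R M < d → ∀ i, d ≤ i → Subsingleton (TopLC R a i M)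
  | 0, M, _, _, _, h, i, _ => by
    have : Subsingleton M := by
      rw [← Module.supportDim_eq_bot_iff_subsingleton R]
      by_contra hne
      obtain ⟨n, hn⟩ := WithBot.ne_bot_iff_exists.1 hne
      rw [← hn] at h
      exact absurd h (not_lt.2 (WithBot.coe_le_coe.2 (zero_le (a := n))))
    exact subsingleton_of_subsingleton a i
  | d + 1, M, _, _, _, h, 0, hi => by omega
  | d + 1, M, _, _, _, h, i + 1, hi => by
    obtain ⟨x, hxa, hx⟩ := exists_isSMulRegular a (torsion_quotient_torsion a M)
    have h₁ := supportDim_quotSMulTop_lt hx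
      ((Module.supportDim_le_of_surjective _ (Submodule.mkQ_surjective (torsion a M))).trans_lt h)
    have := subsingleton_of_supportDim_lt d _ h₁ i (by omega)
    obtain ⟨δ, hδ⟩ := exists_ker_lsmul_surjective a i hx
    suffices Subsingleton (TopLC R a (i + 1) (M ⧸ torsion a M)) from
      (map_mkQ_torsion_injective a i M).subsingleton
    have h₂ : ∀ y : TopLC R a (i + 1) (M ⧸ torsion a M), x • y = 0 → y = 0 := by
      intro y hy
      obtain ⟨z, hz⟩ := hδ ⟨y, hy⟩
      rw [Subsingleton.elim z 0, _root_.map_zero] at hz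
      exact (congrArg Subtype.val hz).symm
    refine subsingleton_of_forall_eq 0 fun y => ?_
    obtain ⟨n, hn⟩ := isTors a (i + 1) _ y
    have h₃ := hn _ (Ideal.pow_mem_pow hxa n)
    clear hn
    induction n with
    | zero => simpa using h₃
    | succ n ih => exact ih (h₂ _ (by rw [← mul_smul, ← pow_succ', h₃]))

/-- Top local cohomology modules are Artinian. -/
theorem isArtinian_of_supportDim_lt : ∀ (d : ℕ) (M : Type) [AddCommGroup M] [Module R M]
    [Module.Finite R M], Module.supportDim R M < (d + 1 : ℕ) → IsArtinian R (TopLC R a d M)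
  | 0, M, _, _, _, h => by
    have := isArtinian_of_supportDim_lt_one (R := R) (M := M) (by simpa using h)
    exact isArtinian_of_injective (ev a M) (ev_injective a)
  | d + 1, M, _, _, _, h => by
    obtain ⟨x, hxa, hx⟩ := exists_isSMulRegular a (torsion_quotient_torsion a M)
    have h₁ := supportDim_quotSMulTop_lt hx
      ((Module.supportDim_le_of_surjective _ (Submodule.mkQ_surjective (torsion a M))).trans_lt h)
    have := isArtinian_of_supportDim_lt d _ h₁
    obtain ⟨δ, hδ⟩ := exists_ker_lsmul_surjective a d hx
    have := isArtinian_of_surjective _ δ hδ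
    have := isArtinian_of_isArtinian_ker_lsmul (H := TopLC R a (d + 1) (M ⧸ torsion a M)) x fun y => by
      obtain ⟨n, hn⟩ := isTors a (d + 1) _ y
      exact ⟨n, hn _ (Ideal.pow_mem_pow hxa n)⟩
    exact isArtinian_of_injective _ (map_mkQ_torsion_injective a d M)

variable {M N : Type} [AddCommGroup M] [Module R M] [Module.Finite R M]
  [AddCommGroup N] [Module R N] {d : ℕ}

/-- Top local cohomology is right exact. -/
theorem map_surjective (hM : Module.supportDim R M < (d + 1 : ℕ)) (f : M →ₗ[R] N)
    (hf : Function.Surjective f) : Function.Surjective (map a d f) := by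
  obtain ⟨δ, -, h, -⟩ := exists_delta a d (LinearMap.ker f).subtype f
    (Submodule.subtype_injective _) hf (LinearMap.exact_subtype_ker_map f)
  have := subsingleton_of_supportDim_lt a (d + 1) (LinearMap.ker f)
    ((Module.supportDim_le_of_injective _ (Submodule.subtype_injective _)).trans_lt hM) _ le_rfl
  exact fun x => (h x).1 (Subsingleton.elim _ _)

theorem ker_map_mkQ_smul_top (hM : Module.supportDim R M < (d + 1 : ℕ)) (J : Ideal R) :
    LinearMap.ker (map a d (J • (⊤ : Submodule R M)).mkQ) =
      J • (⊤ : Submodule R (TopLC R a d M)) := by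
  classical
  refine le_antisymm ?_ ?_
  · obtain ⟨s, hs⟩ := IsNoetherian.noetherian J
    let K := J • (⊤ : Submodule R M)
    have hsJ : ∀ r : s, (r : R) ∈ J := fun r => hs ▸ Submodule.subset_span r.2
    let σ : (s → M) →ₗ[R] M := ∑ r : s, (r : R) • LinearMap.proj r
    have hmem : ∀ v, σ v ∈ K := fun v => by
      rw [LinearMap.sum_apply]
      exact sum_mem fun r _ => Submodule.smul_mem_smul (hsJ r) trivial
    let u : (s → M) →ₗ[R] K := σ.codRestrict K hmem
    have hu : Function.Surjective u := by
      rintro ⟨m, hm⟩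
      suffices h : K ≤ LinearMap.range σ by
        obtain ⟨v, hv⟩ := h hm
        exact ⟨v, Subtype.ext hv⟩
      have : K = Submodule.span R (s : Set R) • (⊤ : Submodule R M) := by rw [hs]
      rw [this, Submodule.smul_le]
      intro r hr m _
      induction hr using Submodule.span_induction with
      | mem r hr =>
        refine ⟨Pi.single ⟨r, hr⟩ m, ?_⟩
        rw [LinearMap.sum_apply, Finset.sum_eq_single ⟨r, hr⟩]
        · simp
        · intro k _ hk
          simp [hk]
        · simp
      | zero => rw [zero_smul]; exact zero_mem _
      | add x y _ _ hx hy => rw [add_smul]; exact add_mem hx hy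
      | smul c x _ hx => rw [smul_assoc]; exact Submodule.smul_mem _ c hx
    have hdim : Module.supportDim R (s → M) < (d + 1 : ℕ) := by
      refine (supportDim_le_of_annihilator_le fun r hr => ?_).trans_lt hM
      rw [Module.mem_annihilator] at hr ⊢
      exact fun v => funext fun k => hr (v k)
    intro x hx
    obtain ⟨y, rfl⟩ := (exact_map_subtype_map_mkQ a d K x).1 hx
    obtain ⟨v, rfl⟩ := map_surjective a hdim u hu y
    rw [map_map]
    have : K.subtype ∘ₗ u = ∑ r : s, (r : R) • LinearMap.proj r := rfl
    rw [this, TopLC.map_sum, LinearMap.sum_apply]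
    refine sum_mem fun r _ => ?_
    rw [TopLC.map_smul, LinearMap.smul_apply]
    exact Submodule.smul_mem_smul (hsJ r) trivial
  · refine Submodule.smul_le.2 fun r hr x _ => ?_
    have h₁ : r • (J • (⊤ : Submodule R M)).mkQ = 0 := by
      ext m
      exact (Submodule.Quotient.mk_eq_zero _).2 (Submodule.smul_mem_smul hr trivial)
    rw [LinearMap.mem_ker, _root_.map_smul, ← LinearMap.smul_apply, ← TopLC.map_smul, h₁,
      TopLC.map_zero, LinearMap.zero_apply]

theorem nonempty_equiv_quotient (hM : Module.supportDim R M < (d + 1 : ℕ)) (J : Ideal R) :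
    Nonempty ((TopLC R a d M ⧸ J • (⊤ : Submodule R (TopLC R a d M))) ≃ₗ[R]
      TopLC R a d (M ⧸ J • (⊤ : Submodule R M))) :=
  ⟨Submodule.quotEquivOfEq _ _ (ker_map_mkQ_smul_top a hM J).symm ≪≫ₗ
    (map a d (J • (⊤ : Submodule R M)).mkQ).quotKerEquivOfSurjective
      (map_surjective a hM _ (Submodule.mkQ_surjective _))⟩

end Top

end TopLC

/-- A module is Artinian if its submodule annihilated by finitely many locally nilpotent elements
is Artinian. -/
theorem isArtinian_of_isArtinian_torsionBySet {A : Type*} [CommRing A] (s : Finset A) :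
    ∀ (E : Type) [AddCommGroup E] [Module A E], (∀ x ∈ s, ∀ e : E, ∃ n : ℕ, x ^ n • e = 0) →
      IsArtinian A (Submodule.torsionBySet A E (s : Set A)) → IsArtinian A E := by
  classical
  induction s using Finset.induction_on with
  | empty =>
    intro E _ _ _ h
    have h₁ : Submodule.torsionBySet A E ((∅ : Finset A) : Set A) = ⊤ :=
      top_le_iff.1 fun e _ => (Submodule.mem_torsionBySet_iff _ _).2 fun ⟨x, hx⟩ => by simp at hx
    rw [h₁] at h
    exact isArtinian_of_surjective _ _ (Submodule.topEquiv (R := A) (M := E)).surjective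
  | insert x s hx ih =>
    intro E _ _ hs h
    have := ih (LinearMap.ker (LinearMap.lsmul A E x)) (fun y hy e => by
      obtain ⟨n, hn⟩ := hs y (Finset.mem_insert_of_mem hy) e
      exact ⟨n, Subtype.ext hn⟩) (by
      refine isArtinian_of_injective (M := Submodule.torsionBySet A
        (LinearMap.ker (LinearMap.lsmul A E x)) (s : Set A))
        (((Submodule.subtype _).comp (Submodule.subtype _)).codRestrict
          (Submodule.torsionBySet A E ((insert x s : Finset A) : Set A)) ?_) ?_
      · rintro ⟨⟨e, he⟩, he'⟩
        refine (Submodule.mem_torsionBySet_iff _ _).2 ?_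
        rintro ⟨y, hy⟩
        rcases Finset.mem_insert.1 (Finset.mem_coe.1 hy) with rfl | hy
        · exact he
        · exact congrArg Subtype.val ((Submodule.mem_torsionBySet_iff _ _).1 he' ⟨y, hy⟩)
      · intro u v huv
        exact Subtype.ext (Subtype.ext (congrArg (fun w : Submodule.torsionBySet A E
          ((insert x s : Finset A) : Set A) => (w : E)) huv)))
    exact isArtinian_of_isArtinian_ker_lsmul x (hs x (Finset.mem_insert_self _ _))

namespace TopLC

section Matlis

variable {A : Type} [CommRing A] {𝔐 : Ideal A}

lemma isSemisimpleModule_torsionBySet [IsSemisimpleRing (A ⧸ 𝔐)] (E : Type) [AddCommGroup E]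
    [Module A E] : IsSemisimpleModule A (Submodule.torsionBySet A E (𝔐 : Set A)) := by
  have h := Submodule.torsionBySet_isTorsionBySet (R := A) (M := E) (𝔐 : Set A)
  exact h.isSemisimpleModule_iff.1 inferInstance

lemma isArtinian_of_isTors [IsNoetherianRing A] {E : Type} [AddCommGroup E] [Module A E]
    (hE : IsTors 𝔐 E) [h : IsArtinian A (Submodule.torsionBySet A E (𝔐 : Set A))] :
    IsArtinian A E := by
  obtain ⟨s, rfl⟩ := IsNoetherian.noetherian 𝔐
  refine isArtinian_of_isArtinian_torsionBySet s E (fun x hx e => ?_) ?_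
  · obtain ⟨n, hn⟩ := hE e
    exact ⟨n, hn _ (Ideal.pow_mem_pow (Ideal.subset_span hx) n)⟩
  · rwa [Submodule.torsionBySet_eq_torsionBySet_span]

/-- A nonzero `𝔐`-torsion module has nonzero `𝔐`-socle: every nonzero element has a nonzero
multiple killed by `𝔐`. -/
lemma IsTors.exists_smul_mem_torsionBySet {E : Type} [AddCommGroup E] [Module A E]
    (hE : IsTors 𝔐 E) {e : E} (he : e ≠ 0) :
    ∃ c : A, c • e ≠ 0 ∧ c • e ∈ Submodule.torsionBySet A E (𝔐 : Set A) := by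
  classical
  have hex := hE e
  let n := Nat.find hex
  have hn : ∀ r ∈ 𝔐 ^ n, r • e = 0 := Nat.find_spec hex
  have hmin : ∀ k < n, ¬ ∀ r ∈ 𝔐 ^ k, r • e = 0 := fun k hk => Nat.find_min hex hk
  rcases hnk : n with _ | k
  · rw [hnk] at hn
    exact absurd (by simpa using hn 1 (by simp)) he
  · have := hmin k (by omega)
    push Not at this
    obtain ⟨c, hc, hce⟩ := this
    refine ⟨c, hce, (Submodule.mem_torsionBySet_iff _ _).2 fun ⟨r, hr⟩ => ?_⟩
    rw [smul_smul]
    exact hn _ (by rw [hnk, pow_succ']; exact Ideal.mul_mem_mul hr hc)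

/-- An `𝔐`-torsion injective module `E` whose `𝔐`-socle is isomorphic to `A ⧸ 𝔐`. -/
theorem exists_injective_hull [IsNoetherianRing A] [IsSemisimpleRing (A ⧸ 𝔐)] :
    ∃ (E : Type) (_ : AddCommGroup E) (_ : Module A E) (i : (A ⧸ 𝔐) →ₗ[A] E),
      Module.Injective A E ∧ IsTors 𝔐 E ∧ Function.Injective i ∧
      LinearMap.range i = Submodule.torsionBySet A E (𝔐 : Set A) := by
  have hT : IsTors 𝔐 (A ⧸ 𝔐) := fun m => ⟨1, fun r hr => by
    obtain ⟨m, rfl⟩ := Ideal.Quotient.mk_surjective m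
    rw [pow_one] at hr
    rw [← Ideal.Quotient.mk_eq_mk, ← Submodule.Quotient.mk_smul, Submodule.Quotient.mk_eq_zero]
    exact 𝔐.mul_mem_right _ hr⟩
  obtain ⟨Γ, _, _, hΓ, hΓt, i₀, hi₀⟩ := exists_torsion_injective_embedding 𝔐 hT
  obtain ⟨J, hJ⟩ := zorn_le₀ {J : Submodule A Γ | Disjoint J (LinearMap.range i₀)} (by
    intro c hc hchain
    refine ⟨sSup c, ?_, fun x hx => le_sSup hx⟩
    rcases c.eq_empty_or_nonempty with rfl | hne
    · simp
    · refine Submodule.disjoint_def.2 fun x hx hx' => ?_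
      obtain ⟨y, hy, hxy⟩ := (Submodule.mem_sSup_of_directed hne hchain.directedOn).1 hx
      exact Submodule.disjoint_def.1 (hc hy) x hxy hx')
  have hJd : Disjoint J (LinearMap.range i₀) := hJ.prop
  let i : (A ⧸ 𝔐) →ₗ[A] (Γ ⧸ J) := J.mkQ ∘ₗ i₀
  have hi : Function.Injective i := by
    refine (injective_iff_map_eq_zero i).2 fun x hx => hi₀ ?_
    rw [_root_.map_zero]
    exact Submodule.disjoint_def.1 hJd _ ((Submodule.Quotient.mk_eq_zero J).1 hx) ⟨x, rfl⟩
  have hess : ∀ N : Submodule A (Γ ⧸ J), Disjoint N (LinearMap.range i) → N = ⊥ := by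
    intro N hN
    have h₁ : Disjoint (N.comap J.mkQ) (LinearMap.range i₀) := by
      refine Submodule.disjoint_def.2 ?_
      rintro _ hx ⟨x, rfl⟩
      have := Submodule.disjoint_def.1 hN (i x) hx ⟨x, rfl⟩
      rw [hi (this.trans (_root_.map_zero i).symm), _root_.map_zero]
    have h₂ : N.comap J.mkQ ≤ J := hJ.le_of_ge h₁ (fun x hx => by
      rw [Submodule.mem_comap, Submodule.mkQ_apply, (Submodule.Quotient.mk_eq_zero J).2 hx]
      exact N.zero_mem)
    refine (Submodule.eq_bot_iff _).2 fun y hy => ?_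
    obtain ⟨x, rfl⟩ := J.mkQ_surjective y
    exact (Submodule.Quotient.mk_eq_zero J).2 (h₂ hy)
  have hEt : IsTors 𝔐 (Γ ⧸ J) := hΓt.of_surjective J.mkQ J.mkQ_surjective
  have hle : LinearMap.range i ≤ Submodule.torsionBySet A (Γ ⧸ J) (𝔐 : Set A) := by
    rintro _ ⟨x, rfl⟩
    refine (Submodule.mem_torsionBySet_iff _ _).2 fun ⟨r, hr⟩ => ?_
    obtain ⟨x, rfl⟩ := Ideal.Quotient.mk_surjective x
    have : r • (Ideal.Quotient.mk 𝔐 x) = 0 := by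
      rw [← Ideal.Quotient.mk_eq_mk, ← Submodule.Quotient.mk_smul, Submodule.Quotient.mk_eq_zero]
      exact 𝔐.mul_mem_right _ hr
    change r • i _ = 0
    rw [← _root_.map_smul, this, _root_.map_zero]
  have hss := isSemisimpleModule_torsionBySet (𝔐 := 𝔐) (Γ ⧸ J)
  have hrange : LinearMap.range i = Submodule.torsionBySet A (Γ ⧸ J) (𝔐 : Set A) := by
    set S := Submodule.torsionBySet A (Γ ⧸ J) (𝔐 : Set A)
    obtain ⟨N, hN⟩ := exists_isCompl ((LinearMap.range i).comap S.subtype)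
    have hNb : N.map S.subtype = ⊥ := by
      refine hess _ (Submodule.disjoint_def.2 ?_)
      rintro _ ⟨x, hx, rfl⟩ hx'
      rw [Submodule.disjoint_def.1 hN.disjoint x hx' hx, _root_.map_zero]
    have hNb' : N = ⊥ := (Submodule.map_injective_of_injective S.injective_subtype)
      (hNb.trans (Submodule.map_bot _).symm)
    have := hN.codisjoint.eq_top
    rw [hNb', sup_bot_eq, Submodule.comap_subtype_eq_top] at this
    exact le_antisymm hle this
  have hart : IsArtinian A (A ⧸ 𝔐) :=
    isArtinian_of_surjective_algebraMap (R := A ⧸ 𝔐) Ideal.Quotient.mk_surjective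
  have : IsArtinian A (Submodule.torsionBySet A (Γ ⧸ J) (𝔐 : Set A)) := by
    rw [← hrange]
    infer_instance
  have hEA : IsArtinian A (Γ ⧸ J) := isArtinian_of_isTors hEt
  obtain ⟨g, hg⟩ := Module.Injective.out i hi i₀
  have hπg : Function.Injective (J.mkQ ∘ₗ g) := by
    refine LinearMap.ker_eq_bot.1 (hess _ (Submodule.disjoint_def.2 ?_))
    rintro _ hx ⟨x, rfl⟩
    have : J.mkQ (g (i x)) = 0 := hx
    rw [hg] at this
    exact this
  have hbij : Function.Bijective (J.mkQ ∘ₗ g) :=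
    ⟨hπg, IsArtinian.surjective_of_injective_endomorphism _ hπg⟩
  let e := LinearEquiv.ofBijective _ hbij
  exact ⟨Γ ⧸ J, inferInstance, inferInstance, i,
    injective_of_leftInverse (g ∘ₗ e.symm.toLinearMap) J.mkQ (fun x => e.apply_symm_apply x),
    hEt, hi, hrange⟩

end Matlis

end TopLC

lemma mem_smul_top_pi {A : Type*} [CommRing A] {n : ℕ} {J : Ideal A} {x : Fin n → A}
    (hx : ∀ k, x k ∈ J) : x ∈ (J • ⊤ : Submodule A (Fin n → A)) := by
  rw [pi_eq_sum_univ x]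
  exact Submodule.sum_mem _ fun k _ => Submodule.smul_mem_smul (hx k) trivial

lemma isPrecomplete_pi {A : Type*} [CommRing A] (I : Ideal A) [h : IsPrecomplete I A] (n : ℕ) :
    IsPrecomplete I (Fin n → A) := by
  refine ⟨fun f hf => ?_⟩
  have hf' : ∀ k : Fin n, ∃ L : A, ∀ m, f m k ≡ L [SMOD (I ^ m • ⊤ : Submodule A A)] := fun k =>
    h.prec fun {p q} hpq => by
      have h₁ := SModEq.sub_mem.1 (hf hpq)
      rw [SModEq.sub_mem]
      have h₂ := Submodule.mem_map_of_mem (f := LinearMap.proj (R := A) (φ := fun _ : Fin n => A) k) h₁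
      rw [Submodule.map_smul''] at h₂
      exact (smul_mono_right (I ^ p) le_top : I ^ p • _ ≤ I ^ p • (⊤ : Submodule A A)) h₂
  choose L hL using hf'
  refine ⟨L, fun m => SModEq.sub_mem.2 (mem_smul_top_pi fun k => ?_)⟩
  simpa using SModEq.sub_mem.1 (hL k m)

namespace TopLC

section Matlis

variable {A : Type} [CommRing A] {𝔐 : Ideal A}
  {H E : Type} [AddCommGroup H] [Module A H] [AddCommGroup E] [Module A E]

lemma IsTors.isHausdorff_linearMap (hH : IsTors 𝔐 H) : IsHausdorff 𝔐 (H →ₗ[A] E) := by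
  refine ⟨fun f hf => LinearMap.ext fun h => ?_⟩
  obtain ⟨n, hn⟩ := hH h
  have h₁ := SModEq.zero.1 (hf n)
  refine Submodule.smul_induction_on (p := fun g : H →ₗ[A] E => g h = 0) h₁ ?_ ?_
  · intro r hr g _
    rw [LinearMap.smul_apply, ← _root_.map_smul, hn r hr, _root_.map_zero]
  · intro g g' hg hg'
    rw [LinearMap.add_apply, hg, hg', add_zero]

/-- A map to an injective module vanishing on the `𝔐`-socle is a combination of maps with
coefficients in `𝔐`. -/
lemma mem_smul_top_of_vanish [IsNoetherianRing A] [Module.Injective A E] (f : H →ₗ[A] E)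
    (hf : ∀ h ∈ Submodule.torsionBySet A H (𝔐 : Set A), f h = 0) :
    f ∈ (𝔐 • ⊤ : Submodule A (H →ₗ[A] E)) := by
  classical
  obtain ⟨s, hs⟩ := IsNoetherian.noetherian 𝔐
  let X : H →ₗ[A] (s → H) := LinearMap.pi fun x => LinearMap.lsmul A H x
  have hX : LinearMap.ker X ≤ LinearMap.ker f := by
    intro h hh
    refine hf h ?_
    rw [← hs, ← Submodule.torsionBySet_eq_torsionBySet_span, Submodule.mem_torsionBySet_iff]
    exact fun x => congrFun (show X h = 0 from hh) x
  obtain ⟨g, hg⟩ := Module.Injective.out ((LinearMap.ker X).liftQ X le_rfl)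
    (LinearMap.ker_eq_bot.1 (Submodule.ker_liftQ_eq_bot _ _ _ le_rfl))
    ((LinearMap.ker X).liftQ f hX)
  have h₁ : f = ∑ x : s, (x : A) • (g ∘ₗ LinearMap.single A (fun _ : s => H) x) := by
    ext h
    have h₂ := hg ((LinearMap.ker X).mkQ h)
    simp only [Submodule.mkQ_apply, Submodule.liftQ_apply] at h₂
    rw [← h₂, LinearMap.sum_apply]
    have h₃ : X h = ∑ x : s, Pi.single x (X h x) := (Finset.univ_sum_single _).symm
    rw [h₃, _root_.map_sum]
    refine Finset.sum_congr rfl fun x _ => ?_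
    rw [LinearMap.smul_apply, ← _root_.map_smul]
    rfl
  rw [h₁]
  refine Submodule.sum_mem _ fun x _ => Submodule.smul_mem_smul ?_ trivial
  rw [← hs]
  exact Submodule.subset_span x.2

/-- Over a complete semilocal ring, the Matlis dual of an Artinian module is finitely generated. -/
lemma finite_linearMap [IsNoetherianRing A] [IsAdicComplete 𝔐 A] [IsSemisimpleRing (A ⧸ 𝔐)]
    [IsArtinian A H] (hH : IsTors 𝔐 H) [Module.Injective A E]
    [IsNoetherian A (Submodule.torsionBySet A E (𝔐 : Set A))] :
    Module.Finite A (H →ₗ[A] E) := by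
  have := isSemisimpleModule_torsionBySet (𝔐 := 𝔐) H
  set S := Submodule.torsionBySet A H (𝔐 : Set A)
  set S' := Submodule.torsionBySet A E (𝔐 : Set A)
  have htfae := IsSemisimpleModule.finite_tfae (R := A) (M := S)
  have : Module.Finite A S := (htfae.out 2 0).1 (inferInstance : IsArtinian A S)
  have hSS : ∀ (f : H →ₗ[A] E) (x : S), f x ∈ S' := fun f x =>
    (Submodule.mem_torsionBySet_iff _ _).2 fun r => by
      rw [← _root_.map_smul, (Submodule.mem_torsionBySet_iff _ _).1 x.2 r, _root_.map_zero]
  let ρ : (H →ₗ[A] E) →ₗ[A] (S →ₗ[A] S') :=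
    { toFun := fun f => (f ∘ₗ S.subtype).codRestrict S' (hSS f)
      map_add' := fun f g => rfl
      map_smul' := fun r f => rfl }
  obtain ⟨n, G, hG⟩ := Module.Finite.exists_fin (R := A) (M := LinearMap.range ρ)
  choose l hl using fun k => (G k).2
  let F : (Fin n → A) →ₗ[A] (H →ₗ[A] E) := Fintype.linearCombination A l
  have hF : LinearMap.range ρ ≤ LinearMap.range (ρ ∘ₗ F) := by
    have h₁ := congrArg (Submodule.map (LinearMap.range ρ).subtype) hG
    rw [Submodule.map_subtype_top, Submodule.map_span] at h₁
    rw [← h₁, Submodule.span_le]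
    rintro _ ⟨_, ⟨k, rfl⟩, rfl⟩
    refine ⟨Pi.single k 1, ?_⟩
    rw [LinearMap.comp_apply, Fintype.linearCombination_apply_single, one_smul]
    exact hl k
  have hsurj : Function.Surjective (Submodule.mkQ (𝔐 • ⊤ : Submodule A (H →ₗ[A] E)) ∘ₗ F) := by
    intro y
    obtain ⟨f, rfl⟩ := Submodule.mkQ_surjective _ y
    obtain ⟨c, hc⟩ := hF ⟨f, rfl⟩
    refine ⟨c, (Submodule.Quotient.eq _).2 (mem_smul_top_of_vanish _ fun h hh => ?_)⟩
    have := congrArg Subtype.val (LinearMap.congr_fun hc ⟨h, hh⟩)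
    exact sub_eq_zero.2 this
  have := hH.isHausdorff_linearMap (E := E)
  have := isPrecomplete_pi 𝔐 n
  exact Module.Finite.of_surjective F (surjective_of_mkQ_comp_surjective (I := 𝔐) hsurj)

lemma exists_linearMap_ne_zero [IsSemisimpleRing (A ⧸ 𝔐)] [Module.Injective A E]
    (i : (A ⧸ 𝔐) →ₗ[A] E) (hi : Function.Injective i) (hH : IsTors 𝔐 H) {h : H} (hh : h ≠ 0) :
    ∃ f : H →ₗ[A] E, f h ≠ 0 := by
  obtain ⟨c, hc, hc'⟩ := hH.exists_smul_mem_torsionBySet hh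
  let q : (A ⧸ 𝔐) →ₗ[A] H := Submodule.liftQ 𝔐 (LinearMap.toSpanSingleton A H (c • h)) (fun r hr =>
    (Submodule.mem_torsionBySet_iff _ _).1 hc' ⟨r, hr⟩)
  have hss : IsSemisimpleModule A (A ⧸ 𝔐) := by
    have hT : Module.IsTorsionBySet A (A ⧸ 𝔐) 𝔐 := fun x r => by
      obtain ⟨x, rfl⟩ := Ideal.Quotient.mk_surjective x
      rw [← Ideal.Quotient.mk_eq_mk, ← Submodule.Quotient.mk_smul, Submodule.Quotient.mk_eq_zero]
      exact 𝔐.mul_mem_right _ r.2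
    exact hT.isSemisimpleModule_iff.1 inferInstance
  obtain ⟨t, ht⟩ := IsSemisimpleModule.lifting_property q.rangeRestrict q.surjective_rangeRestrict
    LinearMap.id
  have ht' : Function.Injective t := Function.LeftInverse.injective (g := q.rangeRestrict) fun x =>
    LinearMap.congr_fun ht x
  obtain ⟨f, hf⟩ := Module.Injective.out (LinearMap.range q).subtype
    (Submodule.injective_subtype _) (i ∘ₗ t)
  have hmem : c • h ∈ LinearMap.range q := ⟨Submodule.Quotient.mk 1, one_smul _ _⟩
  refine ⟨f, fun h₀ => hc ?_⟩
  have h₁ := hf ⟨c • h, hmem⟩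
  rw [Submodule.subtype_apply, _root_.map_smul, h₀, smul_zero] at h₁
  have h₂ : t ⟨c • h, hmem⟩ = 0 := hi (h₁.symm.trans (_root_.map_zero i).symm)
  exact congrArg Subtype.val (ht' (h₂.trans (_root_.map_zero t).symm))

theorem exists_monic_aeval_eq_zero [IsNoetherianRing A] [IsAdicComplete 𝔐 A]
    [IsSemisimpleRing (A ⧸ 𝔐)] [IsArtinian A H] (hH : IsTors 𝔐 H) (φ : Module.End A H) :
    ∃ p : Polynomial A, p.Monic ∧ Polynomial.aeval φ p = 0 := by
  obtain ⟨E, _, _, i, hE, hEt, hi, hr⟩ := exists_injective_hull (𝔐 := 𝔐)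
  have : IsNoetherian A (Submodule.torsionBySet A E (𝔐 : Set A)) := by
    rw [← hr]
    infer_instance
  have := finite_linearMap (𝔐 := 𝔐) (E := E) hH
  let ψ : Module.End A (H →ₗ[A] E) := LinearMap.lcomp A E φ
  obtain ⟨p, hp, hp'⟩ := LinearMap.exists_monic_and_aeval_eq_zero A ψ
  refine ⟨p, hp, LinearMap.ext fun h => ?_⟩
  have key : ∀ (p : Polynomial A) (f : H →ₗ[A] E),
      Polynomial.aeval ψ p f = f ∘ₗ Polynomial.aeval φ p := fun p f => by
    induction p using Polynomial.induction_on' with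
    | add p q hp hq => rw [_root_.map_add, _root_.map_add, LinearMap.add_apply, hp, hq,
        LinearMap.comp_add]
    | monomial n c =>
      rw [Polynomial.aeval_monomial, Polynomial.aeval_monomial, ← Algebra.smul_def,
        ← Algebra.smul_def, LinearMap.smul_apply, LinearMap.comp_smul]
      congr 1
      induction n with
      | zero => rfl
      | succ n ih =>
        rw [pow_succ', Module.End.mul_apply, ih, pow_succ]
        rfl
  by_contra hne
  obtain ⟨f, hf⟩ := exists_linearMap_ne_zero i hi hH hne
  have := LinearMap.congr_fun (key p f) h
  rw [hp'] at this
  exact hf this.symm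

end Matlis

end TopLC

namespace TopLC

section Vanishing

open scoped Pointwise in
lemma lsmul_surjective_of_isSMulRegular {R M : Type} [CommRing R] [IsNoetherianRing R]
    (a : Ideal R) [AddCommGroup M] [Module R M] [Module.Finite R M] {x : R}
    (hx : IsSMulRegular M x) {d : ℕ} (h : Module.supportDim R M < (d + 1 : ℕ)) :
    Function.Surjective (LinearMap.lsmul R (TopLC R a d M) x) := by
  have hex : Function.Exact (LinearMap.lsmul R M x) (x • (⊤ : Submodule R M)).mkQ := by
    intro m
    rw [← LinearMap.mem_ker, Submodule.ker_mkQ]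
    exact ⟨fun ⟨y, _, e⟩ => ⟨y, e⟩, fun ⟨y, e⟩ => ⟨y, trivial, e⟩⟩
  obtain ⟨δ, h₁, -, -⟩ := exists_delta a d (LinearMap.lsmul R M x) (x • (⊤ : Submodule R M)).mkQ
    hx (Submodule.mkQ_surjective _) hex
  have hm : map a d (LinearMap.lsmul R M x) = LinearMap.lsmul R _ x := by
    have : LinearMap.lsmul R M x = x • LinearMap.id := rfl
    rw [this, TopLC.map_smul, map_id]
    rfl
  rw [hm] at h₁
  have : Subsingleton (TopLC R a d (QuotSMulTop x M)) :=
    subsingleton_of_supportDim_lt a d _ (supportDim_quotSMulTop_lt hx h) d le_rfl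
  exact fun y => (h₁ y).1 (Subsingleton.elim (α := TopLC R a d (QuotSMulTop x M)) _ _)

lemma isTors_of_isArtinian {T H : Type} [CommRing T] [IsNoetherianRing T] {𝔐 : Ideal T}
    (h𝔐 : 𝔐 ≤ Ideal.jacobson ⊥) [AddCommGroup H] [Module T H] [IsArtinian T H] :
    IsTors 𝔐 H := by
  intro h
  let f : ℕ →o (Submodule T H)ᵒᵈ :=
    ⟨fun n => OrderDual.toDual (𝔐 ^ n • Submodule.span T {h}), fun m n hmn =>
      Submodule.smul_mono_left (Ideal.pow_le_pow_right hmn)⟩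
  obtain ⟨n, hn⟩ := IsArtinian.monotone_stabilizes f
  have h₁ : 𝔐 ^ n • Submodule.span T {h} = 𝔐 ^ (n + 1) • Submodule.span T {h} :=
    hn (n + 1) n.le_succ
  have h₂ : 𝔐 ^ n • Submodule.span T {h} = ⊥ := by
    refine Submodule.eq_bot_of_le_smul_of_le_jacobson_bot 𝔐 _ ?_ ?_ h𝔐
    · exact Submodule.FG.smul ((isNoetherianRing_iff_ideal_fg T).1 inferInstance _)
        (Submodule.fg_span_singleton h)
    · rw [← Submodule.mul_smul, ← pow_succ']
      exact h₁.le
  refine ⟨n, fun r hr => ?_⟩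
  have := Submodule.smul_mem_smul hr (Submodule.mem_span_singleton_self (R := T) h)
  rwa [h₂, Submodule.mem_bot] at this

variable {T : Type} [CommRing T] [IsNoetherianRing T] (a : Ideal T)

/-- If `y` acts surjectively on an Artinian module and `s` kills the kernel of `y`, then
some `g ≡ s ^ n` modulo `y` kills the module. -/
lemma exists_smul_eq_zero_of_surjective (𝔐 : Ideal T) [IsAdicComplete 𝔐 T]
    [IsSemisimpleRing (T ⧸ 𝔐)] {H : Type} [AddCommGroup H] [Module T H] [IsArtinian T H]
    {y s : T} (hy : Function.Surjective (LinearMap.lsmul T H y))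
    (hs : ∀ h : H, y • h = 0 → s • h = 0) :
    ∃ (n : ℕ) (g : T), g - s ^ n ∈ Ideal.span {y} ∧ ∀ h : H, g • h = 0 := by
  let φ : Module.End T H :=
    ((LinearMap.ker (LinearMap.lsmul T H y)).liftQ (LinearMap.lsmul T H s) hs) ∘ₗ
      ((LinearMap.lsmul T H y).quotKerEquivOfSurjective hy).symm.toLinearMap
  have hφ : ∀ h : H, φ (y • h) = s • h := fun h => by
    have : ((LinearMap.lsmul T H y).quotKerEquivOfSurjective hy).symm (y • h) =
        Submodule.Quotient.mk h := by
      rw [LinearEquiv.symm_apply_eq]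
      rfl
    change Submodule.liftQ _ _ hs (((LinearMap.lsmul T H y).quotKerEquivOfSurjective hy).symm
      (y • h)) = _
    rw [this]
    rfl
  obtain ⟨p, hp, hp'⟩ := exists_monic_aeval_eq_zero
    (isTors_of_isArtinian (IsAdicComplete.le_jacobson_bot 𝔐)) φ
  have h₁ : algebraMap T (Module.End T H) y * φ = algebraMap T (Module.End T H) s := by
    ext h
    rw [Module.End.mul_apply, Module.algebraMap_end_apply, Module.algebraMap_end_apply,
      ← _root_.map_smul, hφ]
  have h₂ := Polynomial.scaleRoots_aeval_eq_zero (r := y) hp'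
  rw [h₁, Polynomial.aeval_algebraMap_apply] at h₂
  refine ⟨p.natDegree, Polynomial.aeval s (p.scaleRoots y), ?_, fun h => LinearMap.congr_fun h₂ h⟩
  rw [Polynomial.aeval_eq_sum_range, Polynomial.natDegree_scaleRoots, Finset.sum_range_succ,
    Polynomial.coeff_scaleRoots, Nat.sub_self, pow_zero, mul_one, hp.coeff_natDegree, one_smul,
    add_sub_cancel_right]
  refine Ideal.sum_mem _ fun k hk => ?_
  rw [Polynomial.coeff_scaleRoots, smul_eq_mul]
  refine Ideal.mul_mem_right _ _ (Ideal.mul_mem_left _ _ (Ideal.pow_mem_of_mem _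
    (Ideal.mem_span_singleton_self y) _ ?_))
  have := Finset.mem_range.1 hk
  omega

/-- Dévissage from cyclic modules `T ⧸ p` to finitely generated modules. -/
lemma exists_notMem_of_forall_prime {q : Ideal T} [hq : q.IsPrime] {d : ℕ}
    (H : ∀ p : Ideal T, p.IsPrime → p ≤ q → Module.supportDim T (T ⧸ p) < (d + 1 : ℕ) →
      Subsingleton (TopLC T a d (T ⧸ p)))
    (N : Type) [AddCommGroup N] [Module T N] [hN : Module.Finite T N] :
    Module.supportDim T N < (d + 1 : ℕ) →
      ∃ s ∉ q, ∀ h : TopLC T a d N, s • h = 0 := by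
  refine IsNoetherianRing.induction_on_isQuotientEquivQuotientPrime T hN
    (motive := fun N _ _ _ => Module.supportDim T N < (d + 1 : ℕ) →
      ∃ s ∉ q, ∀ h : TopLC T a d N, s • h = 0) ?_ ?_ ?_
  · intro N _ _ _ _ _
    have := subsingleton_of_subsingleton a d (M := N)
    exact ⟨1, (Ideal.ne_top_iff_one q).1 hq.ne_top, fun h => Subsingleton.elim _ _⟩
  · intro N _ _ _ p e hd
    by_cases hpq : p.asIdeal ≤ q
    · have := H p.asIdeal p.isPrime hpq
        ((Module.supportDim_le_of_surjective (e : N →ₗ[T] T ⧸ p.asIdeal) e.surjective).trans_lt hd)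
      have := (mapEquiv a d e).toEquiv.subsingleton
      exact ⟨1, (Ideal.ne_top_iff_one q).1 hq.ne_top, fun h => Subsingleton.elim _ _⟩
    · obtain ⟨s, hs, hsq⟩ := SetLike.not_le_iff_exists.1 hpq
      refine ⟨s, hsq, fun h => ?_⟩
      have h₀ : (s • LinearMap.id : N →ₗ[T] N) = 0 := by
        ext x
        apply e.injective
        rw [LinearMap.smul_apply, _root_.map_smul, LinearMap.zero_apply, _root_.map_zero]
        obtain ⟨t, ht⟩ := Ideal.Quotient.mk_surjective (e x)
        rw [LinearMap.id_apply, ← ht, ← Ideal.Quotient.mk_eq_mk, ← Submodule.Quotient.mk_smul,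
          Submodule.Quotient.mk_eq_zero]
        exact p.asIdeal.mul_mem_right _ hs
      rw [← map_smul_id, h₀, TopLC.map_zero, LinearMap.zero_apply]
  · intro N₁ _ _ _ N₂ _ _ _ N₃ _ _ _ f g hf hg hfg h₁ h₃ hd
    obtain ⟨s, hs, hs'⟩ := h₁ ((Module.supportDim_le_of_injective f hf).trans_lt hd)
    obtain ⟨t, ht, ht'⟩ := h₃ ((Module.supportDim_le_of_surjective g hg).trans_lt hd)
    obtain ⟨δ, hex, -, -⟩ := exists_delta a d f g hf hg hfg
    refine ⟨s * t, fun h => (hq.mem_or_mem h).elim hs ht, fun h => ?_⟩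
    obtain ⟨u, hu⟩ := (hex (t • h)).1 (by rw [_root_.map_smul, ht'])
    rw [mul_smul, ← hu, ← _root_.map_smul, hs', _root_.map_zero]

/-- Lichtenbaum–Hartshorne vanishing over a complete semilocal ring, for cyclic modules. -/
lemma subsingleton_of_not_le {𝔐 : Ideal T} [IsAdicComplete 𝔐 T]
    [IsSemisimpleRing (T ⧸ 𝔐)] {q : Ideal T} [hq : q.IsPrime] (haq : a ≤ q) (h𝔐q : ¬ 𝔐 ≤ q) :
    ∀ (d : ℕ) (p : Ideal T), p.IsPrime → p ≤ q → Module.supportDim T (T ⧸ p) < (d + 1 : ℕ) →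
      Subsingleton (TopLC T a d (T ⧸ p))
  | 0, p, hp, hpq, hd => by
    have : IsArtinian T (T ⧸ p) := isArtinian_of_supportDim_lt_one (by simpa using hd)
    have : IsArtinianRing (T ⧸ p) := isArtinian_of_tower T inferInstance
    have hf : IsField (T ⧸ p) := IsArtinianRing.isField_of_isDomain _
    have hm : p.IsMaximal := Ideal.Quotient.maximal_of_isField _ hf
    exact absurd (((IsAdicComplete.le_jacobson_bot 𝔐).trans
      (sInf_le ⟨bot_le, hm⟩)).trans hpq) h𝔐q
  | d + 1, p, hp, hpq, hd => by
    by_cases hqp : q ≤ p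
    · refine subsingleton_succ_of_isTors a d _ fun x => ⟨1, fun r hr => ?_⟩
      obtain ⟨x, rfl⟩ := Ideal.Quotient.mk_surjective x
      rw [pow_one] at hr
      rw [← Ideal.Quotient.mk_eq_mk, ← Submodule.Quotient.mk_smul, Submodule.Quotient.mk_eq_zero]
      exact p.mul_mem_right _ (hqp (haq hr))
    have hreg : ∀ y ∉ p, IsSMulRegular (T ⧸ p) y := fun y hy => by
      refine isSMulRegular_iff_right_eq_zero_of_smul.2 fun x hx => ?_
      obtain ⟨x, rfl⟩ := Ideal.Quotient.mk_surjective x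
      rw [← Ideal.Quotient.mk_eq_mk, ← Submodule.Quotient.mk_smul,
        Submodule.Quotient.mk_eq_zero] at hx
      exact Ideal.Quotient.eq_zero_iff_mem.2 ((hp.mem_or_mem hx).resolve_left hy)
    obtain ⟨y, hyq, hyp⟩ := SetLike.not_le_iff_exists.1 hqp
    obtain ⟨s, hsq, hs⟩ := exists_notMem_of_forall_prime a (subsingleton_of_not_le haq h𝔐q d)
      (QuotSMulTop y (T ⧸ p)) (supportDim_quotSMulTop_lt (hreg y hyp) hd)
    obtain ⟨δ, hδ⟩ := exists_ker_lsmul_surjective a d (hreg y hyp)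
    have := isArtinian_of_supportDim_lt a (d + 1) (T ⧸ p) hd
    obtain ⟨n, g, hg, hg'⟩ := exists_smul_eq_zero_of_surjective 𝔐 (y := y) (s := s)
      (lsmul_surjective_of_isSMulRegular a (hreg y hyp) hd) (fun h hh => by
        obtain ⟨x, hx⟩ := hδ ⟨h, hh⟩
        have := congrArg Subtype.val (_root_.map_smul δ s x)
        rw [hs, _root_.map_zero, hx] at this
        exact this.symm)
    have hgq : g ∉ q := fun h => hsq (hq.mem_of_pow_mem n (by
      have := q.sub_mem h ((Ideal.span_singleton_le_iff_mem q).2 hyq hg)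
      rwa [sub_sub_cancel] at this))
    have hsurj := lsmul_surjective_of_isSMulRegular a (hreg g fun h => hgq (hpq h)) hd
    refine ⟨fun x x' => ?_⟩
    obtain ⟨x, rfl⟩ := hsurj x
    obtain ⟨x', rfl⟩ := hsurj x'
    exact (hg' x).trans (hg' x').symm

/-- If `q` contains `a` but not `𝔐`, then `H^d_a(N)` is annihilated by an element outside `q`. -/
theorem exists_notMem_smul_eq_zero {𝔐 : Ideal T} [IsAdicComplete 𝔐 T]
    [IsSemisimpleRing (T ⧸ 𝔐)] {q : Ideal T} [q.IsPrime] (haq : a ≤ q) (h𝔐q : ¬ 𝔐 ≤ q)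
    {d : ℕ} (N : Type) [AddCommGroup N] [Module T N] [Module.Finite T N]
    (hd : Module.supportDim T N < (d + 1 : ℕ)) :
    ∃ s ∉ q, ∀ h : TopLC T a d N, s • h = 0 :=
  exists_notMem_of_forall_prime a (subsingleton_of_not_le a haq h𝔐q d) N hd

end Vanishing

end TopLC

section AdicCompletion

open Ideal

variable {R : Type} [CommRing R]

lemma AdicCompletion.factorPow_evalₐ (I : Ideal R) {k l : ℕ} (h : k ≤ l)
    (y : AdicCompletion I R) :
    Ideal.Quotient.factorPow I h (evalₐ I l y) = evalₐ I k y := by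
  induction y using AdicCompletion.induction_on with | h y => ?_
  rw [evalₐ_mk, evalₐ_mk, Ideal.Quotient.factor_mk]
  have := y.2 h
  rw [SModEq.comm, SModEq.sub_mem, smul_eq_mul, Ideal.mul_top] at this
  exact Ideal.Quotient.eq.2 this

lemma AdicCompletion.isAdicComplete_map {I : Ideal R} (hI : I.FG) :
    IsAdicComplete (I.map (algebraMap R (AdicCompletion I R))) (AdicCompletion I R) :=
  (IsAdicComplete.map_algebraMap_iff I _).2 (AdicCompletion.isAdicComplete hI)

lemma AdicCompletion.surjective_mk_map {I : Ideal R} (hI : I.FG) :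
    Function.Surjective ((Ideal.Quotient.mk (I.map (algebraMap R (AdicCompletion I R)))).comp
      (algebraMap R (AdicCompletion I R))) := by
  intro y
  obtain ⟨t, rfl⟩ := Ideal.Quotient.mk_surjective y
  obtain ⟨r, hr⟩ := Ideal.Quotient.mk_surjective (AdicCompletion.evalOneₐ I t)
  have h : algebraMap R (AdicCompletion I R) r - t ∈
      RingHom.ker (AdicCompletion.evalOneₐ I).toRingHom := by
    rw [RingHom.mem_ker, _root_.map_sub, sub_eq_zero]
    exact ((AdicCompletion.evalOneₐ I).commutes r).trans hr
  exact ⟨r, Ideal.Quotient.eq.2 (AdicCompletion.ker_evalOneₐ_eq_map I hI ▸ h)⟩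

lemma AdicCompletion.isNoetherianRing [IsNoetherianRing R] (I : Ideal R) :
    IsNoetherianRing (AdicCompletion I R) := by
  have hfg : I.FG := IsNoetherian.noetherian I
  obtain ⟨n, x, hx⟩ := Submodule.fg_iff_exists_fin_generating_family.1 hfg
  let J := MvPolynomial.idealOfVars (Fin n) R
  let g : MvPolynomial (Fin n) R →+* R := (MvPolynomial.aeval x).toRingHom
  have hgX (i : Fin n) : g (MvPolynomial.X i) = x i := MvPolynomial.aeval_X x i
  have hgC (r : R) : g (MvPolynomial.C r) = r := MvPolynomial.aeval_C x r
  have hJ : J.map g = I := by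
    refine (Ideal.map_span g _).trans (Eq.trans ?_ hx)
    rw [← Set.range_comp]
    exact congrArg (fun y => Ideal.span (Set.range y)) (funext hgX)
  have hle (k : ℕ) : J ^ k ≤ (I ^ k).comap g := by
    rw [← Ideal.map_le_iff_le_comap, Ideal.map_pow, hJ]
  let A := AdicCompletion J (MvPolynomial (Fin n) R)
  let f (k : ℕ) : A →+* R ⧸ I ^ k :=
    (Ideal.quotientMap (I ^ k) g (hle k)).comp (AdicCompletion.evalₐ J k : A →+* _)
  have hf {k l : ℕ} (h : k ≤ l) : (Ideal.Quotient.factorPow I h).comp (f l) = f k := by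
    ext y
    have h₁ : f k y = Ideal.quotientMap (I ^ k) g (hle k)
      (Ideal.Quotient.factorPow J h (AdicCompletion.evalₐ J l y)) := by
      rw [AdicCompletion.factorPow_evalₐ]; rfl
    rw [h₁]
    have h₂ : ((Ideal.Quotient.factorPow I h).comp (f l)) y = Ideal.Quotient.factorPow I h
      (Ideal.quotientMap (I ^ l) g (hle l) (AdicCompletion.evalₐ J l y)) := rfl
    rw [h₂]
    obtain ⟨z, hz⟩ := Ideal.Quotient.mk_surjective (AdicCompletion.evalₐ J l y)
    rw [← hz]
    rfl
  let F : A →+* AdicCompletion I R := AdicCompletion.liftRingHom I f hf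
  have hFof (p : MvPolynomial (Fin n) R) :
      F (algebraMap _ A p) = algebraMap R (AdicCompletion I R) (g p) := by
    refine AdicCompletion.ext_evalₐ fun k => ?_
    refine (AdicCompletion.evalₐ_liftRingHom I f hf k _).trans ?_
    have h₁ : AdicCompletion.evalₐ J k (algebraMap _ A p) = Ideal.Quotient.mk _ p :=
      (AdicCompletion.evalₐ J k).commutes p
    refine (congrArg (Ideal.quotientMap (I ^ k) g (hle k)) h₁).trans ?_
    exact ((AdicCompletion.evalₐ I k).commutes (g p)).symm
  have hJF : (J.map (algebraMap _ A)).map F = I.map (algebraMap R (AdicCompletion I R)) := by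
    refine Eq.trans ?_ (congrArg (Ideal.map (algebraMap R (AdicCompletion I R))) hJ)
    rw [Ideal.map_map, Ideal.map_map]
    exact congrArg (fun φ => Ideal.map φ J) (RingHom.ext hFof)
  have hA : IsAdicComplete (J.map (algebraMap _ A)) A :=
    AdicCompletion.isAdicComplete_map (MvPolynomial.idealOfVars_fg _ _)
  have hT : IsHausdorff ((J.map (algebraMap _ A)).map F) (AdicCompletion I R) := by
    rw [hJF]
    exact (AdicCompletion.isAdicComplete_map hfg).toIsHausdorff
  have hs : Function.Surjective F := by
    refine surjective_of_mk_map_comp_surjective (I := J.map (algebraMap _ A)) F ?_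
    rw [hJF]
    intro y
    obtain ⟨r, rfl⟩ := AdicCompletion.surjective_mk_map hfg y
    refine ⟨algebraMap (MvPolynomial (Fin n) R) A (MvPolynomial.C r), ?_⟩
    simp only [RingHom.comp_apply, hFof, hgC]
  have : IsNoetherianRing A := isNoetherianRing_of_ringEquiv _
    (MvPowerSeries.toAdicCompletionAlgEquiv (Fin n) R).toRingEquiv
  exact isNoetherianRing_of_surjective _ _ F hs

end AdicCompletion

section KrullDim

lemma ringKrullDim_le_of_forall_sub_mem {A S : Type} [CommRing A] [CommRing S]
    [IsNoetherianRing A] [IsNoetherianRing S] (φ : A →+* S) (I : Ideal A)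
    (hI : ∀ P : Ideal S, P.IsMaximal → I ≤ P.comap φ) (hs : ∀ x, ∃ r, φ r - x ∈ I.map φ) :
    ringKrullDim S ≤ ringKrullDim A := by
  let _ := φ.toAlgebra
  refine (ringKrullDim_le_iff_isMaximal_height_le _).2 fun P hP => ?_
  have hPp : P = (P.comap φ).map (algebraMap A S) := by
    refine le_antisymm (fun x hx => ?_) Ideal.map_comap_le
    obtain ⟨r, hr⟩ := hs x
    have hr' : φ r - x ∈ (P.comap φ).map φ := Ideal.map_mono (hI P hP) hr
    have h : r ∈ P.comap φ := by
      have := P.add_mem (Ideal.map_comap_le hr') hx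
      rwa [sub_add_cancel] at this
    have := Ideal.sub_mem _ (Ideal.mem_map_of_mem φ h) hr'
    rwa [sub_sub_cancel] at this
  have : P.LiesOver (P.comap φ) := ⟨rfl⟩
  have h := Ideal.height_le_height_add_of_liesOver (P.comap φ) P
  have hn : Nontrivial (S ⧸ (P.comap φ).map (algebraMap A S)) :=
    Ideal.Quotient.nontrivial_iff.2 (hPp ▸ hP.ne_top)
  rw [Ideal.map_mk_eq_bot_of_le hPp.le, Ideal.height_bot, add_zero] at h
  refine (WithBot.coe_le_coe.2 h).trans ?_
  exact Ideal.height_le_ringKrullDim_of_ne_top (Ideal.IsPrime.ne_top inferInstance)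

lemma supportDim_baseChange_le {R T : Type} [CommRing R] [CommRing T] [Algebra R T]
    [IsNoetherianRing R] [IsNoetherianRing T] (I : Ideal R)
    (hI : I.map (algebraMap R T) ≤ Ideal.jacobson ⊥)
    (hs : Function.Surjective ((Ideal.Quotient.mk (I.map (algebraMap R T))).comp
      (algebraMap R T)))
    (M : Type) [AddCommGroup M] [Module R M] [Module.Finite R M] :
    Module.supportDim T (T ⊗[R] M) ≤ Module.supportDim R M := by
  rw [Module.supportDim_eq_ringKrullDim_quotient_annihilator,
    Module.supportDim_eq_ringKrullDim_quotient_annihilator]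
  let J := Module.annihilator R M
  have hJ : J.map (algebraMap R T) ≤ Module.annihilator T (T ⊗[R] M) := by
    refine Ideal.map_le_iff_le_comap.2 fun r hr => ?_
    refine Module.mem_annihilator.2 fun x => ?_
    rw [algebraMap_smul]
    induction x with
    | zero => rw [smul_zero]
    | tmul t m => rw [← TensorProduct.tmul_smul, Module.mem_annihilator.1 hr, tmul_zero]
    | add x y hx hy => rw [smul_add, hx, hy, add_zero]
  refine (ringKrullDim_le_of_surjective _ (Ideal.Quotient.factor_surjective hJ)).trans ?_
  refine ringKrullDim_le_of_forall_sub_mem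
    (Ideal.quotientMap (J.map (algebraMap R T)) (algebraMap R T) Ideal.le_comap_map)
    (I.map (Ideal.Quotient.mk J)) (fun P hP => ?_) fun x => ?_
  · rw [Ideal.map_le_iff_le_comap, Ideal.comap_comap, Ideal.quotientMap_comp_mk,
      ← Ideal.comap_comap, ← Ideal.map_le_iff_le_comap]
    have : (P.comap (Ideal.Quotient.mk (J.map (algebraMap R T)))).IsMaximal :=
      Ideal.comap_isMaximal_of_surjective _ Ideal.Quotient.mk_surjective
    exact hI.trans (sInf_le ⟨bot_le, this⟩)
  · obtain ⟨t, rfl⟩ := Ideal.Quotient.mk_surjective x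
    obtain ⟨r, hr⟩ := hs (Ideal.Quotient.mk _ t)
    refine ⟨Ideal.Quotient.mk J r, ?_⟩
    rw [Ideal.map_map, Ideal.quotientMap_comp_mk, ← Ideal.map_map, Ideal.quotientMap_mk,
      ← _root_.map_sub]
    exact Ideal.mem_map_of_mem _ (Ideal.Quotient.eq.1 hr)

end KrullDim

section Semisimple

lemma isSemisimpleRing_quotient_iInf {R : Type} [CommRing R] {P : Set (PrimeSpectrum R)}
    (hP : P.Finite) (hmax : ∀ p ∈ P, p.asIdeal.IsMaximal) :
    IsSemisimpleRing (R ⧸ ⨅ p ∈ P, p.asIdeal) := by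
  have : Finite P := hP
  have hcop : Pairwise (Function.onFun IsCoprime fun p : P => p.1.asIdeal) := by
    intro p q hpq
    have := hmax p p.2
    have := hmax q q.2
    exact Ideal.isCoprime_of_isMaximal fun h => hpq (Subtype.ext (PrimeSpectrum.ext h))
  rw [iInf_subtype']
  have (p : P) : IsSemisimpleRing (R ⧸ p.1.asIdeal) := by
    have := hmax p p.2
    let _ := Ideal.Quotient.field p.1.asIdeal
    infer_instance
  exact (Ideal.quotientInfRingEquivPiQuotient _ hcop).symm.isSemisimpleRing

lemma AdicCompletion.isSemisimpleRing_quotient_map {R : Type} [CommRing R] {I : Ideal R}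
    (hI : I.FG) [IsSemisimpleRing (R ⧸ I)] :
    IsSemisimpleRing (AdicCompletion I R ⧸ I.map (algebraMap R (AdicCompletion I R))) := by
  refine RingHom.isSemisimpleRing_of_surjective (Ideal.quotientMap _ (algebraMap R _)
    Ideal.le_comap_map : R ⧸ I →+* _) fun y => ?_
  obtain ⟨r, hr⟩ := AdicCompletion.surjective_mk_map hI y
  exact ⟨Ideal.Quotient.mk I r, hr⟩

end Semisimple

namespace TopLC

section BaseChange

variable {R : Type} [CommRing R] {I : Ideal R}

lemma exists_algebraMap_sub_mem (hI : I.FG) (t : AdicCompletion I R) (n : ℕ) :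
    ∃ r : R, t - algebraMap R (AdicCompletion I R) r ∈
      (I ^ n • ⊤ : Submodule R (AdicCompletion I R)) := by
  obtain ⟨r, hr⟩ := Submodule.mkQ_surjective (I ^ n • ⊤ : Submodule R R) (AdicCompletion.eval I R n t)
  refine ⟨r, ?_⟩
  have h : t - algebraMap R (AdicCompletion I R) r ∈ LinearMap.ker (AdicCompletion.eval I R n) := by
    rw [LinearMap.mem_ker, _root_.map_sub, sub_eq_zero]
    exact hr.symm
  exact (AdicCompletion.pow_smul_top_eq_ker_eval (M := R) hI).symm ▸ h

variable {H : Type} [AddCommGroup H] [Module R H]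

lemma exists_one_tmul_eq (hI : I.FG) (hH : IsTors I H) (x : AdicCompletion I R ⊗[R] H) :
    ∃ h : H, 1 ⊗ₜ h = x := by
  induction x with
  | zero => exact ⟨0, tmul_zero _ _⟩
  | add x y hx hy =>
    obtain ⟨h, rfl⟩ := hx
    obtain ⟨k, rfl⟩ := hy
    exact ⟨h + k, tmul_add _ _ _⟩
  | tmul t h =>
    obtain ⟨n, hn⟩ := hH h
    obtain ⟨r, hr⟩ := exists_algebraMap_sub_mem hI t n
    have h₀ (s : AdicCompletion I R) (hs : s ∈ (I ^ n • ⊤ : Submodule R (AdicCompletion I R))) :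
        s ⊗ₜ[R] h = 0 := by
      induction hs using Submodule.smul_induction_on' with
      | smul r hr s _ => rw [smul_tmul, hn r hr, tmul_zero]
      | add s _ t _ hs ht => rw [add_tmul, hs, ht, add_zero]
    refine ⟨r • h, ?_⟩
    have := h₀ _ hr
    rw [sub_tmul, sub_eq_zero] at this
    rw [this, ← smul_tmul, Algebra.smul_def, mul_one]

/-- A torsion module carrying a compatible module structure over the completion agrees with its
base change to the completion. -/
lemma nonempty_baseChange_equiv_of_isTors (hI : I.FG) (hH : IsTors I H)
    [Module (AdicCompletion I R) H] [IsScalarTower R (AdicCompletion I R) H] :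
    Nonempty (AdicCompletion I R ⊗[R] H ≃ₗ[AdicCompletion I R] H) := by
  let f := (LinearMap.id : H →ₗ[R] H).liftBaseChange (AdicCompletion I R)
  have hf (h : H) : f (1 ⊗ₜ h) = h := by simp [f]
  refine ⟨LinearEquiv.ofBijective f ⟨(injective_iff_map_eq_zero f).2 fun x hx => ?_,
    fun h => ⟨1 ⊗ₜ h, hf h⟩⟩⟩
  obtain ⟨h, rfl⟩ := exists_one_tmul_eq hI hH x
  rw [← hf h, hx, tmul_zero]

lemma isTors_of_support_eq [IsNoetherianRing R] {P : Set (PrimeSpectrum R)}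
    (hH : Module.support R H = P) :
    IsTors (⨅ p ∈ P, p.asIdeal) H := by
  intro h
  have hle : (⨅ p ∈ P, p.asIdeal) ≤ (Ideal.torsionOf R H h).radical := by
    rw [Ideal.radical_eq_sInf]
    refine le_sInf fun p ⟨hp, hp'⟩ => ?_
    refine iInf₂_le (⟨p, hp'⟩ : PrimeSpectrum R) ?_
    rw [← hH, Module.mem_support_iff_exists_annihilator]
    refine ⟨h, ?_⟩
    rwa [Submodule.annihilator_span_singleton]
  obtain ⟨n, hn⟩ := Ideal.exists_pow_le_of_le_radical_of_fg hle (IsNoetherian.noetherian _)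
  exact ⟨n, fun r hr => hn hr⟩

lemma le_of_mem_support {a : Ideal R} (hH : IsTors a H) {p : PrimeSpectrum R}
    (hp : p ∈ Module.support R H) : a ≤ p.asIdeal := by
  obtain ⟨h, hh⟩ := Module.mem_support_iff_exists_annihilator.1 hp
  obtain ⟨n, hn⟩ := hH h
  refine p.2.le_of_pow_le (n := n) fun r hr => hh ?_
  exact (Submodule.mem_annihilator_span_singleton _ _).2 (hn r hr)

end BaseChange

end TopLC

section Secondary

variable {T H : Type} [CommRing T] [AddCommGroup H] [Module T H]

lemma IsSecondarySub.sup {A B : Submodule T H} (hA : IsSecondarySub T A)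
    (hB : IsSecondarySub T B) (h : A.annihilator.radical = B.annihilator.radical) :
    IsSecondarySub T (A ⊔ B) := by
  refine ⟨fun h => hA.1 (eq_bot_mono le_sup_left h), fun r => ?_⟩
  by_cases hr : r ∈ A.annihilator.radical
  · have hr' := h ▸ hr
    obtain ⟨m, hm⟩ := hr
    obtain ⟨n, hn⟩ := hr'
    refine Or.inr ⟨m + n, fun x hx => ?_⟩
    obtain ⟨y, hy, z, hz, rfl⟩ := Submodule.mem_sup.1 hx
    rw [smul_add, pow_add, mul_smul, mul_smul, Submodule.mem_annihilator.1 hn z hz, smul_zero,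
      add_zero, smul_comm, Submodule.mem_annihilator.1 hm y hy, smul_zero]
  · have key (C : Submodule T H) (hC : IsSecondarySub T C) (hr : r ∉ C.annihilator.radical) :
        ∀ m ∈ C, ∃ s ∈ C, r • s = m := by
      refine (hC.2 r).resolve_right fun ⟨n, hn⟩ => hr ⟨n, Submodule.mem_annihilator.2 hn⟩
    left
    intro x hx
    obtain ⟨y, hy, z, hz, rfl⟩ := Submodule.mem_sup.1 hx
    obtain ⟨y', hy', rfl⟩ := key A hA hr y hy
    obtain ⟨z', hz', rfl⟩ := key B hB (h ▸ hr) z hz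
    exact ⟨y' + z', Submodule.add_mem_sup hy' hz', smul_add _ _ _⟩

lemma Submodule.exists_lt_sup_eq_of_not_isSecondarySub [IsArtinian T H] {N : Submodule T H}
    (hN : N ≠ ⊥) (h : ¬ IsSecondarySub T N) : ∃ A B : Submodule T H, A < N ∧ B < N ∧ A ⊔ B = N := by
  obtain ⟨r, hr⟩ := not_forall.1 (not_and.1 h hN)
  obtain ⟨hs, hn⟩ := not_or.1 hr
  let f : ℕ →o (Submodule T H)ᵒᵈ :=
    ⟨fun k => OrderDual.toDual (N.map (LinearMap.lsmul T H (r ^ k))), by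
      intro k l hkl
      change N.map (LinearMap.lsmul T H (r ^ l)) ≤ N.map (LinearMap.lsmul T H (r ^ k))
      rintro _ ⟨x, hx, rfl⟩
      refine ⟨r ^ (l - k) • x, N.smul_mem _ hx, ?_⟩
      simp only [LinearMap.lsmul_apply]
      rw [← mul_smul, ← pow_add, Nat.add_sub_cancel' hkl]⟩
  obtain ⟨n, hst⟩ := IsArtinian.monotone_stabilizes f
  have hst' (k : ℕ) (hk : n ≤ k) :
      N.map (LinearMap.lsmul T H (r ^ n)) = N.map (LinearMap.lsmul T H (r ^ k)) := hst k hk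
  refine ⟨N ⊓ LinearMap.ker (LinearMap.lsmul T H (r ^ n)), N.map (LinearMap.lsmul T H (r ^ n)),
    lt_of_le_of_ne inf_le_left fun e => hn ⟨n, fun m hm => (inf_eq_left.1 e) hm⟩,
    lt_of_le_of_ne ?_ fun e => hs fun m hm => ?_, le_antisymm ?_ fun x hx => ?_⟩
  · rintro _ ⟨x, hx, rfl⟩
    exact N.smul_mem _ hx
  · rw [← e, hst' (n + 1) n.le_succ] at hm
    obtain ⟨x, hx, rfl⟩ := hm
    refine ⟨r ^ n • x, N.smul_mem _ hx, ?_⟩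
    rw [LinearMap.lsmul_apply, pow_succ', mul_smul]
  · refine sup_le inf_le_left ?_
    rintro _ ⟨x, hx, rfl⟩
    exact N.smul_mem _ hx
  · have : r ^ n • x ∈ N.map (LinearMap.lsmul T H (r ^ (n + n))) :=
      hst' (n + n) (Nat.le_add_left n n) ▸ ⟨x, hx, rfl⟩
    obtain ⟨y, hy, e⟩ := this
    rw [LinearMap.lsmul_apply, pow_add, mul_smul] at e
    refine Submodule.mem_sup.2 ⟨x - r ^ n • y, ⟨N.sub_mem hx (N.smul_mem _ hy), ?_⟩, r ^ n • y,
      ⟨y, hy, rfl⟩, sub_add_cancel _ _⟩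
    rw [SetLike.mem_coe, LinearMap.mem_ker, LinearMap.lsmul_apply, smul_sub, e, sub_self]

lemma Submodule.exists_finset_isSecondarySub [IsArtinian T H] (N : Submodule T H) :
    ∃ s : Finset (Submodule T H), (∀ S ∈ s, IsSecondarySub T S) ∧ s.sup id = N := by
  classical
  induction N using WellFoundedLT.induction with | ind N ih =>
  by_cases hN : N = ⊥
  · exact ⟨∅, by simp, by simp [hN]⟩
  by_cases h : IsSecondarySub T N
  · exact ⟨{N}, by simpa using h, by simp⟩
  obtain ⟨A, B, hA, hB, rfl⟩ := exists_lt_sup_eq_of_not_isSecondarySub hN h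
  obtain ⟨s, hs, es⟩ := ih A hA
  obtain ⟨t, ht, et⟩ := ih B hB
  refine ⟨s ∪ t, fun S hS => (Finset.mem_union.1 hS).elim (hs S) (ht S), ?_⟩
  rw [Finset.sup_union, es, et]

variable (T H) in
lemma exists_isMinimalRep [IsArtinian T H] :
    ∃ (n : ℕ) (S : Fin n → Submodule T H), IsMinimalRep T S := by
  classical
  let p (k : ℕ) : Prop := ∃ s : Finset (Submodule T H),
    (∀ S ∈ s, IsSecondarySub T S) ∧ s.sup id = ⊤ ∧ s.card = k
  have hp : ∃ k, p k := by
    obtain ⟨s, hs, hs'⟩ := (⊤ : Submodule T H).exists_finset_isSecondarySub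
    exact ⟨s.card, s, hs, hs', rfl⟩
  obtain ⟨s, hs, htop, hcard⟩ := Nat.find_spec hp
  have hmin (t : Finset (Submodule T H)) (ht : ∀ S ∈ t, IsSecondarySub T S)
      (ht' : s.sup id ≤ t.sup id) : s.card ≤ t.card :=
    hcard ▸ Nat.find_min' hp ⟨t, ht, top_le_iff.1 (htop ▸ ht'), rfl⟩
  refine ⟨s.card, fun i => (s.equivFin.symm i).1, fun i => hs _ (s.equivFin.symm i).2,
    top_le_iff.1 (htop ▸ Finset.sup_le fun A hA => ?_), fun i j hij => ?_, fun j hj => ?_⟩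
  · refine le_iSup_of_le (s.equivFin ⟨A, hA⟩) ?_
    exact (congrArg Subtype.val (s.equivFin.symm_apply_apply ⟨A, hA⟩)).ge
  · by_contra hne
    set A := s.equivFin.symm i
    set B := s.equivFin.symm j
    have hAB : A.1 ≠ B.1 := fun e => hne (s.equivFin.symm.injective (Subtype.ext e))
    have h := hmin (insert (A.1 ⊔ B.1) ((s.erase A).erase B)) (fun S hS => ?_)
      (Finset.sup_le fun S hS => ?_)
    · have h₁ := Finset.card_insert_le (A.1 ⊔ B.1) ((s.erase A).erase B)
      have h₂ := Finset.card_erase_of_mem (Finset.mem_erase.2 ⟨hAB.symm, B.2⟩)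
      have h₃ := Finset.card_erase_of_mem A.2
      have h₄ := Finset.card_pos.2 ⟨_, Finset.mem_erase.2 ⟨hAB.symm, B.2⟩⟩
      omega
    · rcases Finset.mem_insert.1 hS with rfl | hS
      · exact (hs A A.2).sup (hs B B.2) hij
      · exact hs S (Finset.mem_of_mem_erase (Finset.mem_of_mem_erase hS))
    · rw [Finset.sup_insert]
      by_cases h₁ : S = A
      · exact le_sup_of_le_left (h₁ ▸ le_sup_left)
      by_cases h₂ : S = B
      · exact le_sup_of_le_left (h₂ ▸ le_sup_right)
      · exact le_sup_of_le_right (Finset.le_sup (f := id)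
          (Finset.mem_erase.2 ⟨h₂, Finset.mem_erase.2 ⟨h₁, hS⟩⟩))
  · set A := s.equivFin.symm j
    have h := hmin (s.erase A) (fun S hS => hs S (Finset.mem_of_mem_erase hS))
      (Finset.sup_le fun S hS => ?_)
    · have := Finset.card_erase_lt_of_mem A.2
      omega
    · by_cases h : S = A
      · subst h
        refine hj.trans (iSup₂_le fun i hi => Finset.le_sup (f := id)
          (Finset.mem_erase.2 ⟨fun e => hi ?_, (s.equivFin.symm i).2⟩))
        exact s.equivFin.symm.injective (Subtype.ext e)
      · exact Finset.le_sup (f := id) (Finset.mem_erase.2 ⟨h, hS⟩)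

variable (T H) in
lemma radical_annihilator_eq_sInf_attachedPrimes [IsArtinian T H] :
    (Module.annihilator T H).radical = sInf (AttachedPrimes T H) := by
  refine le_antisymm (le_sInf ?_) fun x hx => ?_
  · rintro _ ⟨n, S, -, i, rfl⟩
    refine Ideal.radical_mono fun r hr => Submodule.mem_annihilator.2 fun m _ => ?_
    exact Module.mem_annihilator.1 hr m
  · obtain ⟨n, S, hS⟩ := exists_isMinimalRep T H
    have h (i : Fin n) : ∃ k, x ^ k ∈ (S i).annihilator :=
      Ideal.mem_sInf.1 hx ⟨n, S, hS, i, rfl⟩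
    choose k hk using h
    refine ⟨∑ i, k i, ?_⟩
    have : x ^ ∑ i, k i ∈ (⨆ i, S i).annihilator := by
      rw [Submodule.annihilator_iSup]
      refine Ideal.mem_iInf.2 fun i => ?_
      exact Ideal.pow_mem_of_pow_mem _ (hk i)
        (Finset.single_le_sum (fun _ _ => Nat.zero_le _) (Finset.mem_univ i))
    rw [hS.2.1] at this
    exact Module.mem_annihilator.2 fun m => Submodule.mem_annihilator.1 this m trivial

end Secondary

namespace TopLC

section Main

section Complete

variable {T : Type} [CommRing T] [IsNoetherianRing T] {𝔐 : Ideal T}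

lemma le_radical_sup_radical_annihilator [IsAdicComplete 𝔐 T] [IsSemisimpleRing (T ⧸ 𝔐)]
    (a : Ideal T) {d : ℕ} (N : Type) [AddCommGroup N] [Module T N] [Module.Finite T N]
    (hN : Module.supportDim T N < (d + 1 : ℕ)) :
    𝔐 ≤ (a ⊔ (Module.annihilator T (TopLC T a d N)).radical).radical := by
  rw [Ideal.radical_eq_sInf]
  refine le_sInf fun q ⟨hq, hq'⟩ => ?_
  by_contra h
  obtain ⟨s, hs, hs'⟩ := exists_notMem_smul_eq_zero a (le_sup_left.trans hq) h N hN
  exact hs (hq (le_sup_right (a := a) (Ideal.le_radical (Module.mem_annihilator.2 hs'))))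

theorem nonempty_equiv_of_radical_annihilator_eq [IsAdicComplete 𝔐 T] [IsSemisimpleRing (T ⧸ 𝔐)]
    {a b : Ideal T} (ha : a ≤ 𝔐) (hb : b ≤ 𝔐) {d : ℕ} (N : Type) [AddCommGroup N] [Module T N]
    [Module.Finite T N] (hN : Module.supportDim T N < (d + 1 : ℕ))
    (h : (Module.annihilator T (TopLC T a d N)).radical =
      (Module.annihilator T (TopLC T b d N)).radical) :
    Nonempty (TopLC T a d N ≃ₗ[T] TopLC T b d N) := by
  set I := (Module.annihilator T (TopLC T a d N)).radical with hI
  have key (c c' : Ideal T) (hc' : c' ≤ 𝔐)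
      (hc : 𝔐 ≤ (c ⊔ I).radical) : (c' ⊔ I).radical ≤ (c ⊔ I).radical :=
    Ideal.radical_le_radical_iff.2 (sup_le (hc'.trans hc) (le_sup_right.trans Ideal.le_radical))
  have hab : (a ⊔ I).radical = (b ⊔ I).radical :=
    le_antisymm (key b a ha (h ▸ le_radical_sup_radical_annihilator b N hN))
      (key a b hb (le_radical_sup_radical_annihilator a N hN))
  obtain ⟨k, hk⟩ := Ideal.exists_pow_le_of_le_radical_of_fg hI.le (IsNoetherian.noetherian I)
  obtain ⟨l, hl⟩ := Ideal.exists_pow_le_of_le_radical_of_fg h.le (IsNoetherian.noetherian I)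
  let J := I ^ (k + l + 1)
  have hJ (c : Ideal T) : (c ⊔ J).radical = (c ⊔ I).radical := by
    rw [Ideal.radical_sup, Ideal.radical_pow _ (k + l).succ_ne_zero, ← Ideal.radical_sup]
  have hJa : J ≤ Module.annihilator T (TopLC T a d N) :=
    (Ideal.pow_le_pow_right (by omega)).trans hk
  have hJb : J ≤ Module.annihilator T (TopLC T b d N) :=
    (Ideal.pow_le_pow_right (by omega)).trans hl
  have hJab : (a ⊔ J).radical = (b ⊔ J).radical := by rw [hJ, hJ, hab]
  have hquot (c : Ideal T) (hc : J ≤ Module.annihilator T (TopLC T c d N)) :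
      Nonempty (TopLC T c d N ≃ₗ[T] TopLC T c d (N ⧸ (J • ⊤ : Submodule T N))) := by
    obtain ⟨e⟩ := nonempty_equiv_quotient c hN J
    have : (J • ⊤ : Submodule T (TopLC T c d N)) = ⊥ := by
      rw [eq_bot_iff, Submodule.smul_le]
      exact fun r hr x _ => Module.mem_annihilator.1 (hc hr) x
    exact ⟨(Submodule.quotEquivOfEqBot _ this).symm ≪≫ₗ e⟩
  obtain ⟨e₁⟩ := hquot a hJa
  obtain ⟨e₂⟩ := hquot b hJb
  obtain ⟨e₃⟩ := nonempty_equiv_of_radical_eq hJab d (N ⧸ (J • ⊤ : Submodule T N)) (by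
    intro m
    refine ⟨1, fun r hr => ?_⟩
    obtain ⟨m, rfl⟩ := Submodule.mkQ_surjective _ m
    rw [pow_one] at hr
    rw [← _root_.map_smul]
    exact (Submodule.Quotient.mk_eq_zero _).2 (Submodule.smul_mem_smul hr trivial))
  exact ⟨e₁ ≪≫ₗ e₃ ≪≫ₗ e₂.symm⟩

end Complete

section Completion

variable {R : Type} [CommRing R] [IsNoetherianRing R] {𝔐 : Ideal R} {M : Type} [AddCommGroup M]
  [Module R M] {d : ℕ}

lemma nonempty_equiv_adicCompletion {a : Ideal R}
    [Module (AdicCompletion 𝔐 R) (TopLC R a d M)]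
    [IsScalarTower R (AdicCompletion 𝔐 R) (TopLC R a d M)] (h : IsTors 𝔐 (TopLC R a d M)) :
    Nonempty (TopLC R a d M ≃ₗ[AdicCompletion 𝔐 R] TopLC (AdicCompletion 𝔐 R)
      (a.map (algebraMap R (AdicCompletion 𝔐 R))) d (AdicCompletion 𝔐 R ⊗[R] M)) := by
  have := AdicCompletion.isNoetherianRing 𝔐
  have : Module.Flat R (AdicCompletion 𝔐 R) := AdicCompletion.flat_of_isNoetherian 𝔐
  obtain ⟨e₁⟩ := nonempty_baseChange_equiv_of_isTors (IsNoetherian.noetherian 𝔐) h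
  obtain ⟨e₂⟩ := nonempty_equiv_baseChange (AdicCompletion 𝔐 R) a d M
  exact ⟨e₁.symm ≪≫ₗ e₂⟩

theorem nonempty_equiv_of_attachedPrimes_eq [Module.Finite R M]
    (hM : Module.supportDim R M < (d + 1 : ℕ)) [IsSemisimpleRing (R ⧸ 𝔐)] {a b : Ideal R}
    (ha : a ≤ 𝔐) (hb : b ≤ 𝔐)
    [Module (AdicCompletion 𝔐 R) (TopLC R a d M)]
    [IsScalarTower R (AdicCompletion 𝔐 R) (TopLC R a d M)] (hta : IsTors 𝔐 (TopLC R a d M))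
    [Module (AdicCompletion 𝔐 R) (TopLC R b d M)]
    [IsScalarTower R (AdicCompletion 𝔐 R) (TopLC R b d M)] (htb : IsTors 𝔐 (TopLC R b d M))
    (h : AttachedPrimes (AdicCompletion 𝔐 R) (TopLC R a d M) =
      AttachedPrimes (AdicCompletion 𝔐 R) (TopLC R b d M)) :
    Nonempty (TopLC R a d M ≃ₗ[R] TopLC R b d M) := by
  have hfg : 𝔐.FG := IsNoetherian.noetherian 𝔐
  have := AdicCompletion.isNoetherianRing 𝔐
  have hc := AdicCompletion.isAdicComplete_map hfg
  have := AdicCompletion.isSemisimpleRing_quotient_map hfg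
  have (c : Ideal R) [Module (AdicCompletion 𝔐 R) (TopLC R c d M)]
      [IsScalarTower R (AdicCompletion 𝔐 R) (TopLC R c d M)] :
      IsArtinian (AdicCompletion 𝔐 R) (TopLC R c d M) := by
    have := isArtinian_of_supportDim_lt c d M hM
    exact isArtinian_of_tower R this
  obtain ⟨ea⟩ := nonempty_equiv_adicCompletion hta
  obtain ⟨eb⟩ := nonempty_equiv_adicCompletion htb
  have hN := (supportDim_baseChange_le 𝔐 (IsAdicComplete.le_jacobson_bot _)
    (AdicCompletion.surjective_mk_map hfg) M).trans_lt hM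
  obtain ⟨e⟩ := nonempty_equiv_of_radical_annihilator_eq (Ideal.map_mono ha) (Ideal.map_mono hb)
    (AdicCompletion 𝔐 R ⊗[R] M) hN (by
      rw [← ea.annihilator_eq, ← eb.annihilator_eq, radical_annihilator_eq_sInf_attachedPrimes,
        radical_annihilator_eq_sInf_attachedPrimes, h])
  exact ⟨(ea ≪≫ₗ e ≪≫ₗ eb.symm).restrictScalars R⟩

end Completion

end Main

end TopLC

/-- With `P` a finite set of maximal ideals, `𝔐 = ∩_{m ∈ P} m`, `T` the
`𝔐`-adic completion of `R`, and ideals `a`, `b` with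
`Supp_R H^d_a(M) = Supp_R H^d_b(M) = P`: if `Att_T H^d_a(M) = Att_T H^d_b(M)` (for the
natural `T`-module structures, i.e. the ones compatible with the `R`-actions), then
`H^d_a(M) ≅ H^d_b(M)` as `R`-modules. -/
theorem stmt_17 (R : Type) [CommRing R] [IsNoetherianRing R]
    (M : Type) [AddCommGroup M] [Module R M] [Module.Finite R M]
    (d : ℕ) (hd : moduleDim R M = (d : WithBot ℕ∞))
    (P : Set (PrimeSpectrum R)) (hPfin : P.Finite) (hPmax : ∀ p ∈ P, p.asIdeal.IsMaximal)
    (𝔐 : Ideal R) (h𝔐 : 𝔐 = ⨅ p ∈ P, p.asIdeal)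
    (a b : Ideal R)
    (hsa : Module.support R (TopLC R a d M) = P)
    (hsb : Module.support R (TopLC R b d M) = P)
    (sa : Module (AdicCompletion 𝔐 R) (TopLC R a d M))
    (sb : Module (AdicCompletion 𝔐 R) (TopLC R b d M))
    (hta : ∀ (r : R) (x : TopLC R a d M),
      (letI := sa; (algebraMap R (AdicCompletion 𝔐 R) r) • x) = r • x)
    (htb : ∀ (r : R) (x : TopLC R b d M),
      (letI := sb; (algebraMap R (AdicCompletion 𝔐 R) r) • x) = r • x)
    (hatt : @AttachedPrimes (AdicCompletion 𝔐 R) _ (TopLC R a d M) _ sa =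
        @AttachedPrimes (AdicCompletion 𝔐 R) _ (TopLC R b d M) _ sb) :
    Nonempty ((TopLC R a d M) ≃ₗ[R] (TopLC R b d M)) := by
  have hM : Module.supportDim R M < (d + 1 : ℕ) := by
    have h : Module.supportDim R M = d := hd
    rw [h]
    exact_mod_cast d.lt_succ_self
  have : IsSemisimpleRing (R ⧸ 𝔐) := h𝔐 ▸ isSemisimpleRing_quotient_iInf hPfin hPmax
  have hle (c : Ideal R) (hc : Module.support R (TopLC R c d M) = P) : c ≤ 𝔐 :=
    h𝔐 ▸ le_iInf₂ fun p hp => TopLC.le_of_mem_support (TopLC.isTors c d M) (hc ▸ hp)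
  have htors (c : Ideal R) (hc : Module.support R (TopLC R c d M) = P) :
      TopLC.IsTors 𝔐 (TopLC R c d M) := h𝔐 ▸ TopLC.isTors_of_support_eq hc
  have := IsScalarTower.of_algebraMap_smul hta
  have := IsScalarTower.of_algebraMap_smul htb
  exact TopLC.nonempty_equiv_of_attachedPrimes_eq hM (hle a hsa) (hle b hsb) (htors a hsa)
    (htors b hsb) hatt
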